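/- Let 0 < ρ < 1/8 and let q₀, q be positive integers with q₀ | q. Let R > 1 and 1 < U < U₁ with U < y and U > (q₀R)^{1+ρ}, and suppose U/(q₀R) is sufficiently large in terms of ρ. Then |Σ_{m ≡ 0 (mod q₀)} h(m)/m| ≤ 2 / (φ(q₀) · log(U₁/U) · log(U/(q₀R))). -/

import Mathlib

open Finset

/-- `e(t) = e^{2πit}`. -/
noncomputable def eF (t : ℝ) : ℂ := Complex.exp (2 * (Real.pi : ℂ) * Complex.I * (t : ℂ))

/-- `G_ℓ(y) = ∑_{r ≤ y, (r,ℓ)=1} μ(r)²/φ(r)`. -/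
noncomputable def Gsum (ℓ : ℕ) (y : ℝ) : ℝ :=
  ∑ r ∈ Finset.Icc 1 ⌊y⌋₊,
    if Nat.gcd r ℓ = 1 then ((ArithmeticFunction.moebius r : ℤ) : ℝ) ^ 2 / (Nat.totient r : ℝ)
    else 0

/-- The Selberg sieve weights `λ(d)`, supported on `d ≤ R`, `(d,q) = 1`. -/
noncomputable def selbergLambda (q : ℕ) (R : ℝ) (d : ℕ) : ℝ :=
  if (d : ℝ) ≤ R ∧ Nat.gcd d q = 1 then
    (d : ℝ) * ((ArithmeticFunction.moebius d : ℤ) : ℝ) / (Nat.totient d : ℝ) *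
      (Gsum (q * d) (R / d) / Gsum q R)
  else 0

/-- The Barban–Vehov type weights `θ'(d)`. -/
noncomputable def bvTheta' (U U₁ : ℝ) (d : ℕ) : ℝ :=
  if (d : ℝ) ≤ U then ((ArithmeticFunction.moebius d : ℤ) : ℝ)
  else if (d : ℝ) ≤ U₁ then
    ((ArithmeticFunction.moebius d : ℤ) : ℝ) * Real.log (U₁ / d) / Real.log (U₁ / U)
  else 0

/-- The complementary weights `θ(d) = μ(d) − θ'(d)`. -/
noncomputable def bvTheta (U U₁ : ℝ) (d : ℕ) : ℝ :=
  ((ArithmeticFunction.moebius d : ℤ) : ℝ) - bvTheta' U U₁ d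

/-- `h(d) = ∑_{lcm(d₁,d₂) = d} λ(d₁) θ'(d₂)`. -/
noncomputable def hFun (q : ℕ) (R U U₁ : ℝ) (d : ℕ) : ℝ :=
  ∑ p ∈ (d.divisors ×ˢ d.divisors).filter (fun p => Nat.lcm p.1 p.2 = d),
    selbergLambda q R p.1 * bvTheta' U U₁ p.2

open Filter Topology MeasureTheory

lemma norm_sub_le_of_deriv_bounds {f f' Φ : ℝ → ℂ} {a M M' : ℝ}
    (hΦ : ∀ x ∈ Set.Icc a (a + 1), HasDerivAt Φ (f x) x)
    (hf : ∀ x ∈ Set.Icc a (a + 1), HasDerivAt f (f' x) x)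
    (hM : ∀ x ∈ Set.Icc a (a + 1), ‖f x‖ ≤ M) (hM' : ∀ x ∈ Set.Icc a (a + 1), ‖f' x‖ ≤ M') :
    ‖f a - (Φ (a + 1) - Φ a)‖ ≤ min (2 * M) M' := by
  have ha : a ∈ Set.Icc a (a + 1) := ⟨le_rfl, by linarith⟩
  have ha' : a + 1 ∈ Set.Icc a (a + 1) := ⟨by linarith, le_rfl⟩
  have hM'0 : 0 ≤ M' := (norm_nonneg _).trans (hM' a ha)
  refine le_min ?_ ?_
  · have h1 := Convex.norm_image_sub_le_of_norm_hasDerivWithin_le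
      (fun x hx => (hΦ x hx).hasDerivWithinAt) hM (convex_Icc a (a + 1)) ha ha'
    have h2 := hM a ha
    have h3 := norm_sub_le (f a) (Φ (a + 1) - Φ a)
    simp only [add_sub_cancel_left, norm_one, mul_one] at h1
    linarith
  · have hosc : ∀ x ∈ Set.Icc a (a + 1), ‖f x - f a‖ ≤ M' := fun x hx => by
      have h1 := Convex.norm_image_sub_le_of_norm_hasDerivWithin_le
        (fun x hx => (hf x hx).hasDerivWithinAt) hM' (convex_Icc a (a + 1)) ha hx
      refine h1.trans (mul_le_of_le_one_right hM'0 ?_)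
      rw [Real.norm_eq_abs, abs_le]
      constructor <;> linarith [hx.1, hx.2]
    have h1 := Convex.norm_image_sub_le_of_norm_hasDerivWithin_le
      (f := fun x : ℝ => Φ x - (x : ℂ) * f a) (f' := fun x => f x - f a)
      (fun x hx => by
        have := (hΦ x hx).fun_sub ((Complex.ofRealCLM.hasDerivAt (x := x)).mul_const (f a))
        simpa using this.hasDerivWithinAt) hosc (convex_Icc a (a + 1)) ha ha'
    simp only [add_sub_cancel_left, norm_one, mul_one] at h1
    rw [← norm_neg, show -(f a - (Φ (a + 1) - Φ a)) =
      Φ (a + 1) - ((a + 1 : ℝ) : ℂ) * f a - (Φ a - (a : ℂ) * f a) by push_cast; ring]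
    exact h1

lemma norm_tsum_add_le {f f' Φ : ℝ → ℂ} {A B θ : ℝ} (hA : 0 < A) (hB : 0 ≤ B) (hθ : 0 < θ)
    (hθ1 : θ ≤ 1) (hΦ : ∀ x, 1 ≤ x → HasDerivAt Φ (f x) x)
    (hf : ∀ x, 1 ≤ x → HasDerivAt f (f' x) x)
    (hM : ∀ x, 1 ≤ x → ‖f x‖ ≤ B * x ^ (θ / 2 - 1))
    (hM' : ∀ x, 1 ≤ x → ‖f' x‖ ≤ A * B * x ^ (θ / 2 - 2))
    (hlim : Tendsto Φ atTop (𝓝 0)) (hsum : Summable fun n : ℕ => f ((n + 1 : ℕ) : ℝ)) :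
    ‖(∑' n : ℕ, f ((n + 1 : ℕ) : ℝ)) + Φ 1‖ ≤
      2 * B * A ^ θ * ∑' n : ℕ, (((n + 1 : ℕ) : ℝ)) ^ (-1 - θ / 2) := by
  set d : ℕ → ℂ := fun n => f ((n + 1 : ℕ) : ℝ) - (Φ ((n + 2 : ℕ) : ℝ) - Φ ((n + 1 : ℕ) : ℝ))
    with hd
  have hdb : ∀ n : ℕ, ‖d n‖ ≤ 2 * B * A ^ θ * (((n + 1 : ℕ) : ℝ)) ^ (-1 - θ / 2) := fun n => by
    have hn : (1 : ℝ) ≤ ((n + 1 : ℕ) : ℝ) := by simp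
    set a : ℝ := ((n + 1 : ℕ) : ℝ) with ha
    have ha0 : 0 < a := by linarith
    have hmono : ∀ x ∈ Set.Icc a (a + 1), ∀ e : ℝ, e ≤ 0 → x ^ e ≤ a ^ e := fun x hx e he =>
      Real.rpow_le_rpow_of_nonpos ha0 hx.1 he
    have key := norm_sub_le_of_deriv_bounds (a := a) (f := f) (f' := f') (Φ := Φ)
      (M := B * a ^ (θ / 2 - 1)) (M' := A * B * a ^ (θ / 2 - 2))
      (fun x hx => hΦ x (hn.trans hx.1)) (fun x hx => hf x (hn.trans hx.1))
      (fun x hx => (hM x (hn.trans hx.1)).trans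
        (mul_le_mul_of_nonneg_left (hmono x hx _ (by linarith)) hB))
      (fun x hx => (hM' x (hn.trans hx.1)).trans
        (mul_le_mul_of_nonneg_left (hmono x hx _ (by linarith)) (by positivity)))
    have hda : d n = f a - (Φ (a + 1) - Φ a) := by
      simp only [hd, ha]; push_cast; ring_nf
    rw [hda]
    refine key.trans ?_
    have hAn : A * B * a ^ (θ / 2 - 2) = B * a ^ (θ / 2 - 1) * (A / a) := by
      rw [show θ / 2 - 2 = θ / 2 - 1 - 1 by ring, Real.rpow_sub_one ha0.ne']; ring
    have hfin : 2 * B * A ^ θ * a ^ (-1 - θ / 2) = 2 * (B * a ^ (θ / 2 - 1)) * (A / a) ^ θ := by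
      rw [Real.div_rpow hA.le ha0.le, show -1 - θ / 2 = θ / 2 - 1 - θ by ring,
        Real.rpow_sub ha0]; ring
    rw [hfin]
    have hP : 0 ≤ B * a ^ (θ / 2 - 1) := by positivity
    rcases le_total 1 (A / a) with h | h
    · exact (min_le_left _ _).trans (le_mul_of_one_le_right (by positivity)
        (Real.one_le_rpow h hθ.le))
    · refine (min_le_right _ _).trans ?_
      rw [hAn]
      have : A / a ≤ (A / a) ^ θ := by
        conv_lhs => rw [← Real.rpow_one (A / a)]
        exact Real.rpow_le_rpow_of_exponent_ge (by positivity) h hθ1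
      nlinarith [mul_le_mul_of_nonneg_left this hP,
        mul_nonneg hP (Real.rpow_nonneg (by positivity : 0 ≤ A / a) θ)]
  have hsumb : Summable fun n : ℕ => 2 * B * A ^ θ * (((n + 1 : ℕ) : ℝ)) ^ (-1 - θ / 2) :=
    ((summable_nat_add_iff (f := fun n : ℕ => (n : ℝ) ^ (-1 - θ / 2)) 1).2
      (Real.summable_nat_rpow.2 (by linarith))).mul_left _
  have hdsum : Summable d := Summable.of_norm_bounded hsumb hdb
  have htele : Tendsto (fun N : ℕ => ∑ n ∈ Finset.range N, d n) atTop
      (𝓝 ((∑' n : ℕ, f ((n + 1 : ℕ) : ℝ)) + Φ 1)) := by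
    have h1 : ∀ N : ℕ, ∑ n ∈ Finset.range N, d n =
        (∑ n ∈ Finset.range N, f ((n + 1 : ℕ) : ℝ)) - (Φ ((N + 1 : ℕ) : ℝ) - Φ 1) := fun N => by
      simp only [hd]
      rw [Finset.sum_sub_distrib]
      have := Finset.sum_range_sub (fun n : ℕ => Φ ((n + 1 : ℕ) : ℝ)) N
      simp only [zero_add, Nat.cast_one] at this
      rw [← this]
    simp only [h1]
    have h2 : Tendsto (fun N : ℕ => Φ ((N + 1 : ℕ) : ℝ)) atTop (𝓝 0) :=
      hlim.comp (tendsto_natCast_atTop_atTop.comp (tendsto_add_atTop_nat 1))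
    have := (hsum.hasSum.tendsto_sum_nat).sub (h2.sub_const (Φ 1))
    simpa using this
  rw [← tendsto_nhds_unique hdsum.hasSum.tendsto_sum_nat htele, ← tsum_mul_left]
  exact tsum_of_norm_bounded hsumb.hasSum hdb

lemma tendsto_ofReal_cpow_zero {z : ℂ} (hz : z.re < 0) :
    Tendsto (fun x : ℝ => (x : ℂ) ^ z) atTop (𝓝 0) := by
  rw [tendsto_zero_iff_norm_tendsto_zero]
  have h := tendsto_rpow_neg_atTop (y := -z.re) (by linarith)
  refine h.congr' ?_
  filter_upwards [eventually_gt_atTop 0] with x hx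
  rw [Complex.norm_cpow_eq_rpow_re_of_pos hx, neg_neg]

lemma tendsto_ofReal_cpow_mul_log_zero {z : ℂ} (hz : z.re < 0) :
    Tendsto (fun x : ℝ => (x : ℂ) ^ z * (Real.log x : ℂ)) atTop (𝓝 0) := by
  rw [tendsto_zero_iff_norm_tendsto_zero]
  have h := (isLittleO_log_rpow_atTop (r := -z.re) (by linarith)).tendsto_div_nhds_zero.norm
  rw [norm_zero] at h
  refine h.congr' ?_
  filter_upwards [eventually_gt_atTop 0] with x hx
  rw [norm_mul, Complex.norm_cpow_eq_rpow_re_of_pos hx, norm_div, Complex.norm_real,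
    Real.norm_of_nonneg (Real.rpow_nonneg hx.le _), Real.rpow_neg hx.le, div_inv_eq_mul, mul_comm]

lemma hasDerivAt_ofReal_cpow_neg {x : ℝ} (hx : 1 ≤ x) {z : ℂ} (hz : z ≠ 0) :
    HasDerivAt (fun x : ℝ => (x : ℂ) ^ z) (z * (x : ℂ) ^ (z - 1)) x := by
  have h := hasDerivAt_ofReal_cpow_const' (x := x) (by linarith) (r := z - 1)
    (by intro h; apply hz; linear_combination h)
  have h2 := h.const_mul z
  refine (h2.congr_of_eventuallyEq ?_)
  filter_upwards with y
  simp only [sub_add_cancel]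
  field_simp

lemma norm_ofReal_cpow_le {x : ℝ} (hx : 1 ≤ x) {z : ℂ} {e : ℝ} (hz : z.re ≤ e) :
    ‖(x : ℂ) ^ z‖ ≤ x ^ e := by
  rw [Complex.norm_cpow_eq_rpow_re_of_pos (by linarith)]
  exact Real.rpow_le_rpow_of_exponent_le hx hz

lemma exists_norm_riemannZeta_sub_le {θ : ℝ} (hθ : 0 < θ) (hθ1 : θ ≤ 1) :
    ∃ C : ℝ, 0 < C ∧ ∀ s : ℂ, 1 < s.re →
      ‖riemannZeta s - 1 / (s - 1)‖ ≤ C * (1 + ‖s‖) ^ θ ∧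
      ‖deriv riemannZeta s + 1 / (s - 1) ^ 2‖ ≤ C * (1 + ‖s‖) ^ θ := by
  set S : ℝ := ∑' n : ℕ, (((n + 1 : ℕ) : ℝ)) ^ (-1 - θ / 2) with hS
  set B : ℝ := 1 + 2 / θ with hB
  have hB1 : 1 ≤ B := by rw [hB]; linarith [div_pos two_pos hθ]
  have hS0 : 0 ≤ S := tsum_nonneg fun n => by positivity
  have hlog : ∀ x : ℝ, 1 ≤ x → 1 + Real.log x ≤ B * x ^ (θ / 2) := fun x hx => by
    have h1 := Real.log_le_rpow_div (x := x) (by linarith) (ε := θ / 2) (by linarith)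
    have h2 : 1 ≤ x ^ (θ / 2) := Real.one_le_rpow hx (by linarith)
    rw [hB, add_mul, one_mul]
    refine add_le_add h2 (h1.trans_eq ?_)
    field_simp
  have hsplit : ∀ x : ℝ, 1 ≤ x → ∀ k : ℝ, (1 + Real.log x) * x ^ (-k) ≤ B * x ^ (θ / 2 - k) :=
    fun x hx k => by
      rw [sub_eq_add_neg, Real.rpow_add (by linarith), ← mul_assoc]
      exact mul_le_mul_of_nonneg_right (hlog x hx) (Real.rpow_nonneg (by linarith) _)
  refine ⟨2 * B * S + 1, by positivity, fun s hs => ?_⟩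
  have hs1 : 1 - s ≠ 0 := by
    intro h; rw [← sub_eq_zero.1 h] at hs; simp at hs
  have hs0 : s ≠ 0 := by rintro rfl; simp at hs; linarith
  have hA : 0 < 1 + ‖s‖ := by positivity
  have hfinal : 2 * B * (1 + ‖s‖) ^ θ * S ≤ (2 * B * S + 1) * (1 + ‖s‖) ^ θ := by
    have : 0 ≤ (1 + ‖s‖) ^ θ := by positivity
    nlinarith
  have hΦ1 : ∀ x : ℝ, 1 ≤ x →
      HasDerivAt (fun x : ℝ => (x : ℂ) ^ (1 - s)) ((1 - s) * (x : ℂ) ^ (-s)) x := fun x hx => by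
    have := hasDerivAt_ofReal_cpow_neg hx hs1
    rwa [show 1 - s - 1 = -s by ring] at this
  have hf1 : ∀ x : ℝ, 1 ≤ x →
      HasDerivAt (fun x : ℝ => (x : ℂ) ^ (-s)) (-s * (x : ℂ) ^ (-s - 1)) x := fun x hx =>
    hasDerivAt_ofReal_cpow_neg hx (neg_ne_zero.2 hs0)
  have hlogd : ∀ x : ℝ, 1 ≤ x →
      HasDerivAt (fun x : ℝ => (Real.log x : ℂ)) ((x⁻¹ : ℝ) : ℂ) x := fun x hx =>
    (Real.hasDerivAt_log (by linarith)).ofReal_comp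
  have hxs : ∀ x : ℝ, 1 ≤ x → (x : ℂ) ^ (-s - 1) = (x : ℂ) ^ (-s) * ((x⁻¹ : ℝ) : ℂ) :=
    fun x hx => by
      have hx0 : (x : ℂ) ≠ 0 := by exact_mod_cast (by linarith : x ≠ 0)
      rw [Complex.cpow_sub _ _ hx0, Complex.cpow_one]; push_cast; rw [div_eq_mul_inv]
  have hxs' : ∀ x : ℝ, 1 ≤ x → (x : ℂ) ^ (1 - s) * ((x⁻¹ : ℝ) : ℂ) = (x : ℂ) ^ (-s) :=
    fun x hx => by
      have hx0 : (x : ℂ) ≠ 0 := by exact_mod_cast (by linarith : x ≠ 0)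
      rw [sub_eq_add_neg, Complex.cpow_add _ _ hx0, Complex.cpow_one]; push_cast
      field_simp
  have hn1 : ∀ x : ℝ, 1 ≤ x → ‖(x : ℂ) ^ (-s)‖ ≤ x ^ (-1 : ℝ) := fun x hx =>
    norm_ofReal_cpow_le hx (by simp; linarith)
  have hn2 : ∀ x : ℝ, 1 ≤ x → ‖(x : ℂ) ^ (-s - 1)‖ ≤ x ^ (-2 : ℝ) := fun x hx =>
    norm_ofReal_cpow_le hx (by simp; linarith)
  constructor
  · have hsum : HasSum (fun n : ℕ => (((n + 1 : ℕ) : ℝ) : ℂ) ^ (-s)) (riemannZeta s) := by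
      have h1 := LSeriesHasSum_one hs
      rw [LSeriesHasSum, ← hasSum_nat_add_iff' 1] at h1
      simp only [Finset.range_one, Finset.sum_singleton, LSeries.term_zero, sub_zero] at h1
      refine h1.congr_fun fun n => ?_
      rw [LSeries.term_of_ne_zero (Nat.succ_ne_zero n), Pi.one_apply, Complex.cpow_neg,
        Complex.ofReal_natCast, one_div]
    have := norm_tsum_add_le (f := fun x : ℝ => (x : ℂ) ^ (-s))
      (f' := fun x => -s * (x : ℂ) ^ (-s - 1)) (Φ := fun x : ℝ => (x : ℂ) ^ (1 - s) / (1 - s))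
      (A := 1 + ‖s‖) (B := B) hA (by linarith) hθ hθ1
      (fun x hx => by
        have := (hΦ1 x hx).div_const (1 - s)
        rwa [mul_div_cancel_left₀ _ hs1] at this)
      hf1
      (fun x hx => (hn1 x hx).trans <| by
        refine le_trans ?_ (hsplit x hx 1)
        exact le_mul_of_one_le_left (by positivity) (by linarith [Real.log_nonneg hx]))
      (fun x hx => by
        rw [norm_mul, norm_neg, mul_assoc]
        refine mul_le_mul (by linarith) ((hn2 x hx).trans ?_) (norm_nonneg _) hA.le
        refine le_trans ?_ (hsplit x hx 2)
        exact le_mul_of_one_le_left (by positivity) (by linarith [Real.log_nonneg hx]))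
      (by simpa using (tendsto_ofReal_cpow_zero (z := 1 - s) (by simpa using hs)).div_const (1 - s))
      hsum.summable
    rw [hsum.tsum_eq] at this
    refine le_trans (le_of_eq ?_) (this.trans hfinal)
    congr 1
    simp only [Complex.ofReal_one, Complex.one_cpow]
    rw [← neg_sub s 1, div_neg, sub_eq_add_neg]
  · have hsum : HasSum (fun n : ℕ => (((n + 1 : ℕ) : ℝ) : ℂ) ^ (-s) *
        (Real.log ((n + 1 : ℕ) : ℝ) : ℂ)) (-deriv riemannZeta s) := by
      have hab : LSeries.abscissaOfAbsConv 1 < s.re := by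
        rw [LSeries.abscissaOfAbsConv_one]; exact_mod_cast hs
      have hder : deriv riemannZeta s = deriv (LSeries 1) s := by
        refine Filter.EventuallyEq.deriv_eq ?_
        filter_upwards [(isOpen_lt continuous_const Complex.continuous_re).mem_nhds hs] with w hw
        exact (LSeries_one_eq_riemannZeta hw).symm
      have h1 := (LSeriesSummable_logMul_of_lt_re hab).LSeriesHasSum
      rw [hder, LSeries_deriv hab, neg_neg]
      rw [LSeriesHasSum, ← hasSum_nat_add_iff' 1] at h1
      simp only [Finset.range_one, Finset.sum_singleton, LSeries.term_zero, sub_zero] at h1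
      refine h1.congr_fun fun n => ?_
      rw [LSeries.term_of_ne_zero (Nat.succ_ne_zero n), Complex.cpow_neg,
        Complex.ofReal_natCast, LSeries.logMul, Pi.one_apply, mul_one,
        Complex.ofReal_log (by positivity), Complex.ofReal_natCast, div_eq_inv_mul]
    have := norm_tsum_add_le (f := fun x : ℝ => (x : ℂ) ^ (-s) * (Real.log x : ℂ))
      (f' := fun x => -s * (x : ℂ) ^ (-s - 1) * (Real.log x : ℂ) + (x : ℂ) ^ (-s) * ((x⁻¹ : ℝ) : ℂ))
      (Φ := fun x : ℝ => (x : ℂ) ^ (1 - s) * (Real.log x : ℂ) / (1 - s) -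
        (x : ℂ) ^ (1 - s) / (1 - s) ^ 2)
      (A := 1 + ‖s‖) (B := B) hA (by linarith) hθ hθ1
      (fun x hx => by
        have h1 := (((hΦ1 x hx).mul (hlogd x hx)).div_const (1 - s)).fun_sub
          ((hΦ1 x hx).div_const ((1 - s) ^ 2))
        refine h1.congr_deriv ?_
        rw [hxs' x hx]
        field_simp
        ring)
      (fun x hx => (hf1 x hx).mul (hlogd x hx))
      (fun x hx => by
        rw [norm_mul, Complex.norm_real, Real.norm_of_nonneg (Real.log_nonneg hx)]
        refine le_trans ?_ (hsplit x hx 1)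
        rw [mul_comm]
        exact mul_le_mul (by linarith) (hn1 x hx) (norm_nonneg _)
          (by linarith [Real.log_nonneg hx]))
      (fun x hx => by
        have h0 := Real.log_nonneg hx
        rw [← hxs x hx, mul_assoc]
        refine (norm_add_le _ _).trans ?_
        rw [norm_mul, norm_neg, norm_mul, Complex.norm_real, Real.norm_of_nonneg h0]
        have h2 := hn2 x hx
        calc ‖s‖ * (‖(x : ℂ) ^ (-s - 1)‖ * Real.log x) + ‖(x : ℂ) ^ (-s - 1)‖
            = (‖s‖ * Real.log x + 1) * ‖(x : ℂ) ^ (-s - 1)‖ := by ring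
          _ ≤ ((1 + ‖s‖) * (1 + Real.log x)) * x ^ (-2 : ℝ) :=
              mul_le_mul (by nlinarith [norm_nonneg s]) h2 (norm_nonneg _) (by positivity)
          _ = (1 + ‖s‖) * ((1 + Real.log x) * x ^ (-2 : ℝ)) := by ring
          _ ≤ _ := by
              rw [mul_assoc (1 + ‖s‖)]
              exact mul_le_mul_of_nonneg_left (hsplit x hx 2) hA.le)
      (by
        have hre : (1 - s).re < 0 := by simpa using hs
        simpa using ((tendsto_ofReal_cpow_mul_log_zero hre).div_const (1 - s)).sub
          ((tendsto_ofReal_cpow_zero hre).div_const ((1 - s) ^ 2)))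
      hsum.summable
    rw [hsum.tsum_eq] at this
    refine le_trans (le_of_eq ?_) (this.trans hfinal)
    rw [← norm_neg]
    congr 1
    simp only [Complex.ofReal_one, Complex.one_cpow, Real.log_one, Complex.ofReal_zero, mul_zero,
      zero_div]
    rw [← neg_sub s 1, neg_sq]
    ring

lemma exists_norm_riemannZeta_le :
    ∃ C : ℝ, 1 ≤ C ∧ (∀ x : ℝ, 0 < x → x ≤ 1 → ‖riemannZeta (1 + x)‖ ≤ C / x) ∧
      ∀ s : ℂ, 1 < s.re → s.re ≤ 2 → 1 ≤ |s.im| →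
        ‖riemannZeta s‖ ≤ C * |s.im| ^ (1 / 20 : ℝ) ∧
        ‖deriv riemannZeta s‖ ≤ C * |s.im| ^ (1 / 20 : ℝ) := by
  obtain ⟨C, hC, h⟩ := exists_norm_riemannZeta_sub_le (θ := 1 / 20) (by norm_num) (by norm_num)
  have hrp : ∀ x : ℝ, 1 ≤ x → x ^ (1 / 20 : ℝ) ≤ x := fun x hx => by
    conv_rhs => rw [← Real.rpow_one x]
    exact Real.rpow_le_rpow_of_exponent_le hx (by norm_num)
  refine ⟨1 + 4 * C, by linarith, fun x hx hx1 => ?_, fun s hs1 hs2 ht => ?_⟩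
  · have h1 := (h (1 + x) (by simpa using hx)).1
    rw [add_sub_cancel_left] at h1
    have h2 : ‖(1 + x : ℂ)‖ ≤ 2 := by
      refine (norm_add_le _ _).trans ?_
      rw [norm_one, Complex.norm_real, Real.norm_of_nonneg hx.le]; linarith
    have h3 : (1 + ‖(1 + x : ℂ)‖) ^ (1 / 20 : ℝ) ≤ 3 :=
      (hrp _ (by linarith [norm_nonneg (1 + x : ℂ)])).trans (by linarith)
    have h4 := norm_le_norm_add_norm_sub' (riemannZeta (1 + x)) (1 / (x : ℂ))
    rw [norm_div, norm_one, Complex.norm_real, Real.norm_of_nonneg hx.le] at h4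
    rw [add_div]
    have h5 : 4 * C ≤ 4 * C / x := by
      rw [le_div_iff₀ hx]; nlinarith
    nlinarith
  · have h1 := h s hs1
    have hT : 1 ≤ |s.im| ^ (1 / 20 : ℝ) := Real.one_le_rpow ht (by norm_num)
    have hs : ‖s‖ ≤ 2 + |s.im| := by
      refine (Complex.norm_le_abs_re_add_abs_im s).trans ?_
      rw [abs_of_pos (by linarith : 0 < s.re)]; linarith
    have h3 : (1 + ‖s‖) ^ (1 / 20 : ℝ) ≤ 4 * |s.im| ^ (1 / 20 : ℝ) := by
      calc (1 + ‖s‖) ^ (1 / 20 : ℝ) ≤ (4 * |s.im|) ^ (1 / 20 : ℝ) :=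
            Real.rpow_le_rpow (by positivity) (by linarith) (by norm_num)
        _ = 4 ^ (1 / 20 : ℝ) * |s.im| ^ (1 / 20 : ℝ) :=
            Real.mul_rpow (by norm_num) (by positivity)
        _ ≤ _ := mul_le_mul_of_nonneg_right (hrp 4 (by norm_num)) (by positivity)
    have hn : 1 ≤ ‖s - 1‖ := by
      refine ht.trans ?_
      have := Complex.abs_im_le_norm (s - 1)
      simpa using this
    have hi : ‖1 / (s - 1)‖ ≤ 1 := by
      rw [norm_div, norm_one]; exact div_le_one_of_le₀ hn (by positivity)
    have hi2 : ‖1 / (s - 1) ^ 2‖ ≤ 1 := by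
      rw [norm_div, norm_one, norm_pow]; exact div_le_one_of_le₀ (one_le_pow₀ hn) (by positivity)
    have e1 := norm_le_norm_add_norm_sub' (riemannZeta s) (1 / (s - 1))
    have e2 := norm_sub_le (deriv riemannZeta s + 1 / (s - 1) ^ 2) (1 / (s - 1) ^ 2)
    rw [add_sub_cancel_right] at e2
    constructor <;> nlinarith

lemma one_le_norm_riemannZeta_product {x : ℝ} (hx : 0 < x) (y : ℝ) :
    1 ≤ ‖riemannZeta (1 + x)‖ ^ 3 * ‖riemannZeta (1 + x + Complex.I * y)‖ ^ 4 *
      ‖riemannZeta (1 + x + 2 * Complex.I * y)‖ := by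
  have := DirichletCharacter.norm_LFunction_product_ge_one (N := 1) 1 hx y
  rw [DirichletCharacter.LFunctionTrivChar, DirichletCharacter.LFunction_modOne_eq,
    DirichletCharacter.LFunction_modOne_eq] at this
  simpa [norm_mul, norm_pow] using this

lemma exists_norm_riemannZeta_ge :
    ∃ c : ℝ, 0 < c ∧ ∀ s : ℂ, 1 < s.re → s.re ≤ 2 → 1 ≤ |s.im| →
      c ≤ ‖riemannZeta s‖ * (|s.im| ^ (1 / 20 : ℝ)) ^ 4 := by
  obtain ⟨C, hC, h1, h2⟩ := exists_norm_riemannZeta_le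
  set a : ℝ := 1 / (32 * C ^ 8) with ha
  have hC0 : 0 < C := by linarith
  have ha0 : 0 < a := by positivity
  have ha1 : a ≤ 1 := by
    rw [ha]; apply div_le_one_of_le₀ _ (by positivity)
    linarith [one_le_pow₀ hC (n := 8)]
  have haC : 32 * C ^ 8 * a = 1 := by rw [ha]; field_simp
  -- the bound to the right of the abscissa `1 + a P⁻⁵`
  have far : ∀ (x t : ℝ), 0 < x → x ≤ 1 → 1 ≤ |t| → a ≤ x * (|t| ^ (1 / 20 : ℝ)) ^ 5 →
      2 * a * C ≤ ‖riemannZeta (1 + x + Complex.I * t)‖ * (|t| ^ (1 / 20 : ℝ)) ^ 4 := by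
    intro x t hx hx1 ht hax
    set P : ℝ := |t| ^ (1 / 20 : ℝ) with hP
    have hP1 : 1 ≤ P := Real.one_le_rpow ht (by norm_num)
    have h3 := one_le_norm_riemannZeta_product hx t
    have h4 := h1 x hx hx1
    have h5 : ‖riemannZeta (1 + x + 2 * Complex.I * t)‖ ≤ 2 * C * P := by
      have := (h2 (1 + x + 2 * Complex.I * t) (by simpa using hx) (by simp; linarith)
        (by simp [abs_mul]; linarith)).1
      refine this.trans ?_
      have e : (1 + x + 2 * Complex.I * t : ℂ).im = 2 * t := by simp
      rw [e, abs_mul, Real.mul_rpow (by positivity) (by positivity), ← hP]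
      have : |(2 : ℝ)| ^ (1 / 20 : ℝ) ≤ 2 := by
        rw [abs_of_pos two_pos]
        conv_rhs => rw [← Real.rpow_one 2]
        exact Real.rpow_le_rpow_of_exponent_le (by norm_num) (by norm_num)
      nlinarith [mul_pos hC0 (by linarith : 0 < P)]
    set z := ‖riemannZeta (1 + x + Complex.I * t)‖ with hz
    have hz0 : 0 ≤ z := norm_nonneg _
    have h6 : 1 ≤ (C / x) ^ 3 * z ^ 4 * (2 * C * P) := by
      refine h3.trans ?_
      gcongr
    have h7 : x ^ 3 ≤ 2 * C ^ 4 * P * z ^ 4 := by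
      have : (C / x) ^ 3 * z ^ 4 * (2 * C * P) = 2 * C ^ 4 * P * z ^ 4 / x ^ 3 := by
        field_simp
      rw [this, le_div_iff₀ (by positivity)] at h6
      linarith
    have h8 : (2 * a * C) ^ 4 ≤ (z * P ^ 4) ^ 4 := by
      have h9 : a ^ 3 ≤ x ^ 3 * P ^ 15 := by
        calc a ^ 3 ≤ (x * P ^ 5) ^ 3 := pow_le_pow_left₀ ha0.le hax 3
          _ = _ := by ring
      have h10 : a ^ 3 ≤ 2 * C ^ 4 * P ^ 16 * z ^ 4 := by
        calc a ^ 3 ≤ x ^ 3 * P ^ 15 := h9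
          _ ≤ (2 * C ^ 4 * P * z ^ 4) * P ^ 15 := by gcongr
          _ = _ := by ring
      have h11 : (2 * a * C) ^ 4 * (2 * C ^ 4) = a ^ 3 := by
        calc _ = a ^ 3 * (32 * C ^ 8 * a) := by ring
          _ = _ := by rw [haC, mul_one]
      have h12 : (2 * a * C) ^ 4 * (2 * C ^ 4) ≤ (z * P ^ 4) ^ 4 * (2 * C ^ 4) := by
        rw [h11]; refine h10.trans_eq ?_; ring
      exact le_of_mul_le_mul_right h12 (by positivity)
    exact le_of_pow_le_pow_left₀ (by norm_num) (by positivity) h8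
  refine ⟨a * C, by positivity, fun s hs1 hs2 ht => ?_⟩
  set P : ℝ := |s.im| ^ (1 / 20 : ℝ) with hP
  have hP1 : 1 ≤ P := Real.one_le_rpow ht (by norm_num)
  have hP0 : 0 < P := by linarith
  have hsx : ∀ x : ℝ, (1 + x + Complex.I * s.im : ℂ).re = 1 + x ∧
      (1 + x + Complex.I * s.im : ℂ).im = s.im := fun x => by simp
  have hss : (1 + ((s.re - 1 : ℝ) : ℂ) + Complex.I * s.im : ℂ) = s := by
    apply Complex.ext <;> simp
  rcases le_or_gt a ((s.re - 1) * P ^ 5) with hcase | hcase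
  · have := far (s.re - 1) s.im (by linarith) (by linarith) ht hcase
    rw [hss] at this
    nlinarith
  · set x : ℝ := a / P ^ 5 with hx
    have hx0 : 0 < x := by positivity
    have hxP : x * P ^ 5 = a := by rw [hx]; field_simp
    have hx1 : x ≤ 1 := (div_le_self ha0.le (one_le_pow₀ hP1)).trans ha1
    have hsx' : s.re - 1 < x := by
      rw [hx, lt_div_iff₀ (by positivity)]; exact hcase
    have h3 := far x s.im hx0 hx1 ht hxP.ge
    set w : ℂ := 1 + x + Complex.I * s.im with hw
    have h4 : ‖riemannZeta w - riemannZeta s‖ ≤ C * P * ‖w - s‖ := by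
      refine Convex.norm_image_sub_le_of_norm_deriv_le (𝕜 := ℂ)
        (s := {z | 1 < z.re} ∩ {z | z.re ≤ 2} ∩ ({z | z.im ≤ s.im} ∩ {z | s.im ≤ z.im}))
        ?_ ?_ (((convex_halfSpace_re_gt 1).inter (convex_halfSpace_re_le 2)).inter
          ((convex_halfSpace_im_le _).inter (convex_halfSpace_im_ge _)))
        ⟨⟨hs1, hs2⟩, le_refl s.im, le_refl s.im⟩ ?_
      · rintro z ⟨⟨hz1, -⟩, -⟩
        refine differentiableAt_riemannZeta ?_
        rintro rfl; simp at hz1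
      · rintro z ⟨⟨hz1, hz2⟩, hz3, hz4⟩
        have him : z.im = s.im := le_antisymm hz3 hz4
        have := (h2 z hz1 hz2 (by rw [him]; exact ht)).2
        rwa [him] at this
      · simp only [Set.mem_inter_iff, Set.mem_ofPred_eq, hw, (hsx x).1, (hsx x).2]
        exact ⟨⟨by linarith, by linarith⟩, le_rfl, le_rfl⟩
    have h5 : ‖w - s‖ ≤ x := by
      have : w - s = ((x - (s.re - 1) : ℝ) : ℂ) := by
        apply Complex.ext <;> simp [hw]; ring
      rw [this, Complex.norm_real, Real.norm_of_nonneg (by linarith)]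
      linarith
    have h6 : ‖riemannZeta w‖ ≤ ‖riemannZeta s‖ + C * P * x := by
      have := norm_le_norm_add_norm_sub' (riemannZeta w) (riemannZeta s)
      have h7 : C * P * ‖w - s‖ ≤ C * P * x := by gcongr
      linarith
    have h8 : ‖riemannZeta w‖ * P ^ 4 ≤ ‖riemannZeta s‖ * P ^ 4 + a * C := by
      calc _ ≤ (‖riemannZeta s‖ + C * P * x) * P ^ 4 := by gcongr
        _ = ‖riemannZeta s‖ * P ^ 4 + C * (x * P ^ 5) := by ring
        _ = _ := by rw [hxP]; ring
    linarith

/-- The entire-quotient form of `1 / ((w - 1)² ζ(w)) - 1 / (w - 1)`. -/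
noncomputable def zetaQuotient (w : ℂ) : ℂ := -(riemannZeta₀ w / riemannZeta₁ w)

lemma riemannZeta₁_ne_zero {w : ℂ} (hw : 1 ≤ w.re) : riemannZeta₁ w ≠ 0 := by
  by_cases h : w = 1
  · simp [h]
  · intro h0
    have := riemannZeta_ne_zero_of_one_le_re hw
    rw [riemannZeta_eq_inv_sub_mul h, h0, mul_zero] at this
    exact this rfl

lemma continuousOn_deriv_zetaQuotient : ContinuousOn (deriv zetaQuotient) {w | 1 ≤ w.re} := by
  have hopen : IsOpen {w : ℂ | riemannZeta₁ w ≠ 0} :=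
    isOpen_ne_fun differentiable_riemannZeta₁.continuous continuous_const
  have hd : DifferentiableOn ℂ zetaQuotient {w : ℂ | riemannZeta₁ w ≠ 0} := fun w hw =>
    ((differentiable_riemannZeta₀ w).div (differentiable_riemannZeta₁ w)
      hw).neg.differentiableWithinAt
  exact (hd.deriv hopen).continuousOn.mono fun w hw => riemannZeta₁_ne_zero hw

lemma deriv_zetaQuotient {w : ℂ} (hw : 1 < w.re) :
    deriv zetaQuotient w = -2 / ((w - 1) ^ 3 * riemannZeta w) -
      deriv riemannZeta w / ((w - 1) ^ 2 * riemannZeta w ^ 2) + 1 / (w - 1) ^ 2 := by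
  have hw1 : w ≠ 1 := by rintro rfl; simp at hw
  have hw1' : w - 1 ≠ 0 := sub_ne_zero.2 hw1
  have hz : riemannZeta w ≠ 0 := riemannZeta_ne_zero_of_one_le_re hw.le
  have heq : zetaQuotient =ᶠ[𝓝 w]
      fun w => ((w - 1) ^ 2 * riemannZeta w)⁻¹ - (w - 1)⁻¹ := by
    filter_upwards [(isOpen_lt continuous_const Complex.continuous_re).mem_nhds hw] with v hv
    have hv : 1 < v.re := hv
    have hv1 : v ≠ 1 := by rintro rfl; simp at hv
    have hv1' : v - 1 ≠ 0 := sub_ne_zero.2 hv1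
    have hvz : riemannZeta v ≠ 0 := riemannZeta_ne_zero_of_one_le_re hv.le
    have h1 : riemannZeta₁ v = (v - 1) * riemannZeta v := by
      rw [riemannZeta_eq_inv_sub_mul hv1]; field_simp
    have h0 : riemannZeta₀ v = riemannZeta v - (v - 1)⁻¹ := by
      rw [riemannZeta_eq_inv_sub_add hv1]; ring
    rw [zetaQuotient, h1, h0]
    field_simp
    ring
  rw [heq.deriv_eq]
  have hzd := (differentiableAt_riemannZeta hw1).hasDerivAt
  have hid : HasDerivAt (fun w : ℂ => w - 1) 1 w := (hasDerivAt_id w).sub_const 1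
  have h := (((hid.fun_pow 2).fun_mul hzd).fun_inv (mul_ne_zero (pow_ne_zero 2 hw1') hz)).fun_sub
    (hid.fun_inv hw1')
  rw [h.deriv]
  field_simp
  ring

lemma exists_norm_deriv_zetaQuotient_le :
    ∃ C : ℝ, 0 ≤ C ∧ ∀ s : ℂ, 1 < s.re → s.re ≤ 2 → 1 ≤ |s.im| →
      ‖deriv zetaQuotient s‖ ≤ C * |s.im| ^ (-(3 / 2) : ℝ) := by
  obtain ⟨C, hC, -, h2⟩ := exists_norm_riemannZeta_le
  obtain ⟨c, hc, h3⟩ := exists_norm_riemannZeta_ge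
  have hC0 : 0 < C := by linarith
  refine ⟨2 / c + C / c ^ 2 + 1, by positivity, fun s hs1 hs2 ht => ?_⟩
  have hz := h3 s hs1 hs2 ht
  have hz' := (h2 s hs1 hs2 ht).2
  rw [deriv_zetaQuotient hs1]
  have hw : |s.im| ≤ ‖s - 1‖ := by simpa using Complex.abs_im_le_norm (s - 1)
  set T := |s.im| with hT
  have hT0 : 0 < T := by linarith
  set P : ℝ := T ^ (1 / 20 : ℝ) with hP
  have hP1 : 1 ≤ P := Real.one_le_rpow ht (by norm_num)
  have hP0 : 0 < P := by linarith
  have hPT : T = P ^ 20 := by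
    rw [hP, ← Real.rpow_natCast, ← Real.rpow_mul hT0.le]; norm_num
  have hPT' : T ^ (-(3 / 2) : ℝ) = (P ^ 30)⁻¹ := by
    rw [hP, ← Real.rpow_natCast, ← Real.rpow_mul hT0.le, ← Real.rpow_neg hT0.le]; norm_num
  rw [hPT']
  have hz0 : 0 < ‖riemannZeta s‖ := norm_pos_iff.2 (riemannZeta_ne_zero_of_one_le_re hs1.le)
  have hzl : c / P ^ 4 ≤ ‖riemannZeta s‖ := by rwa [div_le_iff₀ (by positivity)]
  rw [hPT] at hw
  set W := ‖s - 1‖ with hW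
  have hW0 : 0 < W := lt_of_lt_of_le (by positivity) hw
  have e1 : ‖-2 / ((s - 1) ^ 3 * riemannZeta s)‖ ≤ 2 / c * (P ^ 30)⁻¹ := by
    rw [norm_div, norm_neg, norm_mul, norm_pow, ← hW, Complex.norm_ofNat]
    calc 2 / (W ^ 3 * ‖riemannZeta s‖) ≤ 2 / ((P ^ 20) ^ 3 * (c / P ^ 4)) := by gcongr
      _ = 2 / c * (P ^ 56)⁻¹ := by field_simp
      _ ≤ _ := by gcongr; norm_num
  have e2 : ‖deriv riemannZeta s / ((s - 1) ^ 2 * riemannZeta s ^ 2)‖ ≤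
      C / c ^ 2 * (P ^ 30)⁻¹ := by
    rw [norm_div, norm_mul, norm_pow, norm_pow, ← hW]
    calc ‖deriv riemannZeta s‖ / (W ^ 2 * ‖riemannZeta s‖ ^ 2)
        ≤ C * P / ((P ^ 20) ^ 2 * (c / P ^ 4) ^ 2) := by gcongr
      _ = C / c ^ 2 * (P ^ 31)⁻¹ := by field_simp
      _ ≤ _ := by gcongr; norm_num
  have e3 : ‖1 / (s - 1) ^ 2‖ ≤ 1 * (P ^ 30)⁻¹ := by
    rw [norm_div, norm_pow, norm_one, ← hW]
    calc 1 / W ^ 2 ≤ 1 / (P ^ 20) ^ 2 := by gcongr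
      _ = 1 * (P ^ 40)⁻¹ := by field_simp
      _ ≤ _ := by gcongr; norm_num
  refine (norm_add_le _ _).trans ?_
  have := norm_sub_le (-2 / ((s - 1) ^ 3 * riemannZeta s))
    (deriv riemannZeta s / ((s - 1) ^ 2 * riemannZeta s ^ 2))
  linarith

lemma integrable_max_sq_mul_exp {c : ℝ} (hc : 0 < c) :
    Integrable fun u : ℝ => max u 0 ^ 2 * Real.exp (-(c * u)) := by
  have h := integrableOn_rpow_mul_exp_neg_mul_rpow (p := 1) (s := 2) (b := c) (by norm_num)
    one_pos hc
  rw [← integrable_indicator_iff measurableSet_Ioi] at h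
  refine h.congr (Eventually.of_forall fun u => ?_)
  simp only [Set.indicator_apply, Set.mem_Ioi]
  split_ifs with hu
  · rw [max_eq_left hu.le, Real.rpow_one, Real.rpow_two, neg_mul]
  · rw [max_eq_right (not_lt.1 hu)]; simp

lemma integrable_max_mul_exp {c : ℝ} (hc : 0 < c) :
    Integrable fun u : ℝ => max u 0 * Real.exp (-(c * u)) := by
  have h := integrableOn_rpow_mul_exp_neg_mul_rpow (p := 1) (s := 1) (b := c) (by norm_num)
    one_pos hc
  rw [← integrable_indicator_iff measurableSet_Ioi] at h
  refine h.congr (Eventually.of_forall fun u => ?_)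
  simp only [Set.indicator_apply, Set.mem_Ioi]
  split_ifs with hu
  · simp only [max_eq_left hu.le, Real.rpow_one, neg_mul]
  · rw [max_eq_right (not_lt.1 hu)]; simp

lemma max_sq_mul_exp_le {c : ℝ} (hc : 0 < c) (u : ℝ) :
    max u 0 ^ 2 * Real.exp (-(c * u)) ≤ 2 / c ^ 2 := by
  rcases le_total u 0 with hu | hu
  · rw [max_eq_right hu]; simp; positivity
  · rw [max_eq_left hu, Real.exp_neg, ← div_eq_mul_inv, div_le_div_iff₀ (Real.exp_pos _)
      (by positivity)]
    have := Real.quadratic_le_exp_of_nonneg (x := c * u) (by positivity)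
    nlinarith [mul_nonneg hc.le hu]

lemma tendsto_pow_mul_cexp_neg_mul {s : ℂ} (hs : 0 < s.re) (k : ℕ) :
    Tendsto (fun u : ℝ => (u : ℂ) ^ k * Complex.exp (-(s * u))) atTop (𝓝 0) := by
  rw [tendsto_zero_iff_norm_tendsto_zero]
  refine (tendsto_rpow_mul_exp_neg_mul_atTop_nhds_zero k s.re hs).congr' ?_
  filter_upwards [eventually_ge_atTop 0] with u hu
  rw [norm_mul, norm_pow, Complex.norm_real, Real.norm_of_nonneg hu, Complex.norm_exp,
    Real.rpow_natCast]
  simp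

lemma hasDerivAt_cexp_neg_mul (s : ℂ) (u : ℝ) :
    HasDerivAt (fun u : ℝ => Complex.exp (-(s * u))) (-s * Complex.exp (-(s * u))) u := by
  have h : HasDerivAt (fun u : ℝ => -(s * (u : ℂ))) (-s) u := by
    simpa using ((Complex.ofRealCLM.hasDerivAt (x := u)).const_mul s).fun_neg
  simpa [mul_comm] using h.cexp

lemma norm_cexp_neg_mul_ofReal (s : ℂ) (u : ℝ) :
    ‖Complex.exp (-(s * u))‖ = Real.exp (-(s.re * u)) := by
  rw [Complex.norm_exp]; simp

lemma integral_max_mul_cexp {s : ℂ} (hs : 0 < s.re) :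
    ∫ u : ℝ, ((max u 0 : ℝ) : ℂ) * Complex.exp (-(s * u)) = 1 / s ^ 2 := by
  have hs0 : s ≠ 0 := by rintro rfl; simp at hs
  have hIntegrable : Integrable fun u : ℝ => ((max u 0 : ℝ) : ℂ) * Complex.exp (-(s * u)) := by
    refine (integrable_max_mul_exp hs).mono' (by fun_prop) (Eventually.of_forall fun u => ?_)
    rw [norm_mul, norm_cexp_neg_mul_ofReal, Complex.norm_real,
      Real.norm_of_nonneg (le_max_right _ _)]
  have hind : (fun u : ℝ => ((max u 0 : ℝ) : ℂ) * Complex.exp (-(s * u))) =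
      (Set.Ioi 0).indicator fun u : ℝ => (u : ℂ) * Complex.exp (-(s * u)) := by
    funext u
    simp only [Set.indicator_apply, Set.mem_Ioi]
    split_ifs with hu
    · rw [max_eq_left hu.le]
    · rw [max_eq_right (not_lt.1 hu)]; simp
  rw [hind] at hIntegrable ⊢
  rw [integrable_indicator_iff measurableSet_Ioi] at hIntegrable
  rw [integral_indicator measurableSet_Ioi]
  have hd : ∀ u : ℝ, HasDerivAt (fun u : ℝ => -((u : ℂ) * Complex.exp (-(s * u))) / s -
      Complex.exp (-(s * u)) / s ^ 2) ((u : ℂ) * Complex.exp (-(s * u))) u := fun u => by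
    have h1 := hasDerivAt_cexp_neg_mul s u
    have h2 : HasDerivAt (fun u : ℝ => (u : ℂ)) 1 u := Complex.ofRealCLM.hasDerivAt
    refine ((((h2.fun_mul h1).fun_neg).div_const s).fun_sub (h1.div_const (s ^ 2))).congr_deriv ?_
    field_simp
    ring
  have hlim : Tendsto (fun u : ℝ => -((u : ℂ) * Complex.exp (-(s * u))) / s -
      Complex.exp (-(s * u)) / s ^ 2) atTop (𝓝 0) := by
    have h0 := tendsto_pow_mul_cexp_neg_mul hs 0
    have h1 := tendsto_pow_mul_cexp_neg_mul hs 1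
    simp only [pow_zero, one_mul, pow_one] at h0 h1
    simpa using (h1.neg.div_const s).sub (h0.div_const (s ^ 2))
  rw [integral_Ioi_of_hasDerivAt_of_tendsto (hd 0).continuousAt.continuousWithinAt
    (fun u _ => hd u) hIntegrable hlim]
  simp

lemma integral_max_mul_max_mul_cexp {s : ℂ} (hs : 0 < s.re) {a : ℝ} (ha : 0 ≤ a) :
    ∫ u : ℝ, ((max u 0 * max (u - a) 0 : ℝ) : ℂ) * Complex.exp (-(s * u)) =
      Complex.exp (-(s * a)) * (2 / s ^ 3 + a / s ^ 2) := by
  have hs0 : s ≠ 0 := by rintro rfl; simp at hs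
  have hIntegrable : Integrable fun u : ℝ =>
      ((max u 0 * max (u - a) 0 : ℝ) : ℂ) * Complex.exp (-(s * u)) := by
    refine (integrable_max_sq_mul_exp hs).mono' (by fun_prop) (Eventually.of_forall fun u => ?_)
    rw [norm_mul, norm_cexp_neg_mul_ofReal, Complex.norm_real,
      Real.norm_of_nonneg (by positivity), sq]
    gcongr
    linarith
  have hind : (fun u : ℝ => ((max u 0 * max (u - a) 0 : ℝ) : ℂ) * Complex.exp (-(s * u))) =
      (Set.Ioi a).indicator fun u : ℝ => ((u : ℂ) * (u - a)) * Complex.exp (-(s * u)) := by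
    funext u
    simp only [Set.indicator_apply, Set.mem_Ioi]
    split_ifs with hu
    · rw [max_eq_left (by linarith), max_eq_left (by linarith)]; push_cast; ring
    · rw [max_eq_right (a := u - a) (by linarith)]; simp
  rw [hind] at hIntegrable ⊢
  rw [integrable_indicator_iff measurableSet_Ioi] at hIntegrable
  rw [integral_indicator measurableSet_Ioi]
  set G : ℝ → ℂ := fun u => -((u : ℂ) ^ 2 * Complex.exp (-(s * u))) / s +
      (u : ℂ) * Complex.exp (-(s * u)) * (a / s - 2 / s ^ 2) +
      Complex.exp (-(s * u)) * (a / s ^ 2 - 2 / s ^ 3) with hG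
  have hd : ∀ u : ℝ, HasDerivAt G (((u : ℂ) * (u - a)) * Complex.exp (-(s * u))) u := fun u => by
    have h1 := hasDerivAt_cexp_neg_mul s u
    have h2 : HasDerivAt (fun u : ℝ => (u : ℂ)) 1 u := Complex.ofRealCLM.hasDerivAt
    refine (((((h2.fun_pow 2).fun_mul h1).fun_neg).div_const s).fun_add
      ((h2.fun_mul h1).mul_const _) |>.fun_add (h1.mul_const _)).congr_deriv ?_
    field_simp
    ring
  have hlim : Tendsto G atTop (𝓝 0) := by
    have h0 := tendsto_pow_mul_cexp_neg_mul hs 0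
    have h1 := tendsto_pow_mul_cexp_neg_mul hs 1
    have h2 := tendsto_pow_mul_cexp_neg_mul hs 2
    simp only [pow_zero, one_mul, pow_one] at h0 h1
    simpa [hG] using ((h2.neg.div_const s).add (h1.mul_const (a / s - 2 / s ^ 2))).add
      (h0.mul_const (a / s ^ 2 - 2 / s ^ 3))
  rw [integral_Ioi_of_hasDerivAt_of_tendsto (hd a).continuousAt.continuousWithinAt
    (fun u _ => hd u) hIntegrable hlim]
  simp only [hG]
  field_simp
  ring

/-- The `n`-th summand of the damped logarithmic Möbius sum. -/
noncomputable def moebiusTerm (s : ℂ) (n : ℕ) (u : ℝ) : ℂ :=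
  ((ArithmeticFunction.moebius n : ℤ) : ℂ) / n *
    (((max u 0 * max (u - Real.log n) 0 : ℝ) : ℂ) * Complex.exp (-(s * u)))

/-- The damped error term `u (∑_{n ≤ exp u} μ(n) / n (u - log n) - 1) exp (-s u)`, for `u ≥ 0`. -/
noncomputable def moebiusErr (s : ℂ) (u : ℝ) : ℂ :=
  ∑' n, moebiusTerm s n u - ((max u 0 : ℝ) : ℂ) * Complex.exp (-(s * u))

lemma norm_moebius_le (n : ℕ) : ‖((ArithmeticFunction.moebius n : ℤ) : ℂ)‖ ≤ 1 := by
  rw [Complex.norm_intCast]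
  exact_mod_cast ArithmeticFunction.abs_moebius_le_one

lemma norm_moebiusTerm_le {s : ℂ} (hs : 0 < s.re) (n : ℕ) (u : ℝ) :
    ‖moebiusTerm s n u‖ ≤ 1 / (n : ℝ) ^ (1 + s.re / 2) *
      (max u 0 ^ 2 * Real.exp (-(s.re / 2 * u))) := by
  rcases Nat.eq_zero_or_pos n with rfl | hn
  · simp only [moebiusTerm, ArithmeticFunction.map_zero, Int.cast_zero, zero_div, zero_mul,
      norm_zero]
    positivity
  have hn' : (0 : ℝ) < n := by exact_mod_cast hn
  have hlog : 0 ≤ Real.log n := Real.log_natCast_nonneg n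
  rcases le_total u (Real.log n) with hu | hu
  · rw [moebiusTerm, max_eq_right (a := u - Real.log n) (by linarith)]
    simp only [mul_zero, Complex.ofReal_zero, zero_mul, norm_zero]
    positivity
  have hu0 : 0 ≤ u := hlog.trans hu
  rw [moebiusTerm, norm_mul, norm_mul, norm_div, Complex.norm_real, norm_cexp_neg_mul_ofReal,
    Complex.norm_natCast, max_eq_left hu0, max_eq_left (by linarith),
    Real.norm_of_nonneg (mul_nonneg hu0 (by linarith))]
  have hexp : Real.exp (-(s.re * u)) ≤ ((n : ℝ) ^ (s.re / 2))⁻¹ * Real.exp (-(s.re / 2 * u)) := by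
    rw [Real.rpow_def_of_pos hn', ← Real.exp_neg, ← Real.exp_add, Real.exp_le_exp]
    nlinarith
  calc _ ≤ 1 / n * ((u * u) * (((n : ℝ) ^ (s.re / 2))⁻¹ * Real.exp (-(s.re / 2 * u)))) := by
        gcongr
        · exact norm_moebius_le n
        · linarith
    _ = _ := by
        rw [Real.rpow_add hn', Real.rpow_one]
        field_simp

lemma summable_one_div_nat_rpow_half {s : ℂ} (hs : 0 < s.re) :
    Summable fun n : ℕ => 1 / (n : ℝ) ^ (1 + s.re / 2) :=
  Real.summable_one_div_nat_rpow.2 (by linarith)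

lemma continuous_moebiusTerm (s : ℂ) (n : ℕ) : Continuous (moebiusTerm s n) := by
  unfold moebiusTerm; fun_prop

lemma integrable_moebiusTerm {s : ℂ} (hs : 0 < s.re) (n : ℕ) : Integrable (moebiusTerm s n) :=
  ((integrable_max_sq_mul_exp (half_pos hs)).const_mul _).mono'
    (continuous_moebiusTerm s n).aestronglyMeasurable
    (Eventually.of_forall fun u => norm_moebiusTerm_le hs n u)

lemma continuous_moebiusErr {s : ℂ} (hs : 0 < s.re) : Continuous (moebiusErr s) := by
  refine (continuous_tsum (continuous_moebiusTerm s)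
    ((summable_one_div_nat_rpow_half hs).mul_right (2 / (s.re / 2) ^ 2)) fun n u =>
    (norm_moebiusTerm_le hs n u).trans ?_).sub (by fun_prop)
  gcongr
  exact max_sq_mul_exp_le (half_pos hs) u

lemma integrable_ofReal_max_mul_cexp {s : ℂ} (hs : 0 < s.re) :
    Integrable fun u : ℝ => ((max u 0 : ℝ) : ℂ) * Complex.exp (-(s * u)) := by
  refine (integrable_max_mul_exp hs).mono' (by fun_prop) (Eventually.of_forall fun u => ?_)
  rw [norm_mul, norm_cexp_neg_mul_ofReal, Complex.norm_real,
    Real.norm_of_nonneg (le_max_right _ _)]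

lemma integrable_tsum_moebiusTerm {s : ℂ} (hs : 0 < s.re) :
    Integrable fun u => ∑' n, moebiusTerm s n u := by
  have hcont : Continuous fun u => ∑' n, moebiusTerm s n u := by
    have := (continuous_moebiusErr hs).add
      (by fun_prop : Continuous fun u : ℝ => ((max u 0 : ℝ) : ℂ) * Complex.exp (-(s * u)))
    exact this.congr fun u => by simp [moebiusErr]
  refine ((integrable_max_sq_mul_exp (half_pos hs)).const_mul
    (∑' n : ℕ, 1 / (n : ℝ) ^ (1 + s.re / 2))).mono' hcont.aestronglyMeasurable
    (Eventually.of_forall fun u => ?_)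
  exact tsum_of_norm_bounded ((summable_one_div_nat_rpow_half hs).hasSum.mul_right _)
    fun n => norm_moebiusTerm_le hs n u

lemma integrable_moebiusErr {s : ℂ} (hs : 0 < s.re) : Integrable (moebiusErr s) :=
  (integrable_tsum_moebiusTerm hs).sub (integrable_ofReal_max_mul_cexp hs)

lemma summable_integral_norm_moebiusTerm {s : ℂ} (hs : 0 < s.re) :
    Summable fun n => ∫ u, ‖moebiusTerm s n u‖ := by
  refine Summable.of_nonneg_of_le (fun n => integral_nonneg fun u => norm_nonneg _) (fun n => ?_)
    ((summable_one_div_nat_rpow_half hs).mul_right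
      (∫ u : ℝ, max u 0 ^ 2 * Real.exp (-(s.re / 2 * u))))
  rw [← integral_const_mul]
  exact integral_mono (integrable_moebiusTerm hs n).norm
    ((integrable_max_sq_mul_exp (half_pos hs)).const_mul _) fun u => norm_moebiusTerm_le hs n u

lemma integral_moebiusTerm {s : ℂ} (hs : 0 < s.re) (n : ℕ) :
    ∫ u, moebiusTerm s n u =
      2 / s ^ 3 * LSeries.term (fun n => ((ArithmeticFunction.moebius n : ℤ) : ℂ)) (1 + s) n +
      1 / s ^ 2 * LSeries.term
        (LSeries.logMul fun n => ((ArithmeticFunction.moebius n : ℤ) : ℂ)) (1 + s) n := by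
  rcases Nat.eq_zero_or_pos n with rfl | hn
  · simp [moebiusTerm]
  have hn0 : (n : ℂ) ≠ 0 := by exact_mod_cast hn.ne'
  unfold moebiusTerm
  rw [integral_const_mul, integral_max_mul_max_mul_cexp hs (Real.log_natCast_nonneg n),
    LSeries.term_of_ne_zero hn.ne', LSeries.term_of_ne_zero hn.ne', LSeries.logMul,
    Complex.cpow_add _ _ hn0, Complex.cpow_one, Complex.exp_neg, Complex.natCast_log,
    Complex.cpow_def_of_ne_zero hn0 s, mul_comm s]
  have := Complex.exp_ne_zero (Complex.log n * s)
  have hs0 : s ≠ 0 := by rintro rfl; simp at hs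
  field_simp

lemma LSeries_moebius_eq {w : ℂ} (hw : 1 < w.re) :
    LSeries (fun n => ((ArithmeticFunction.moebius n : ℤ) : ℂ)) w = (riemannZeta w)⁻¹ := by
  have h := LSeries_one_mul_Lseries_moebius hw
  rw [LSeries_one_eq_riemannZeta hw] at h
  exact eq_inv_of_mul_eq_one_right h

lemma LSeries_logMul_moebius_eq {w : ℂ} (hw : 1 < w.re) :
    LSeries (LSeries.logMul fun n => ((ArithmeticFunction.moebius n : ℤ) : ℂ)) w =
      deriv riemannZeta w / riemannZeta w ^ 2 := by
  have h := LSeries_deriv (f := fun n => ((ArithmeticFunction.moebius n : ℤ) : ℂ)) (s := w)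
    (by rw [ArithmeticFunction.abscissaOfAbsConv_moebius]; exact_mod_cast hw)
  have heq : LSeries (fun n => ((ArithmeticFunction.moebius n : ℤ) : ℂ)) =ᶠ[𝓝 w]
      fun w => (riemannZeta w)⁻¹ := by
    filter_upwards [(isOpen_lt continuous_const Complex.continuous_re).mem_nhds hw] with v hv
    exact LSeries_moebius_eq hv
  have hw1 : w ≠ 1 := by rintro rfl; simp at hw
  rw [heq.deriv_eq, ((differentiableAt_riemannZeta hw1).hasDerivAt.fun_inv
    (riemannZeta_ne_zero_of_one_le_re hw.le)).deriv, neg_div] at h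
  exact (neg_injective h).symm

lemma integral_moebiusErr {s : ℂ} (hs : 0 < s.re) :
    ∫ u, moebiusErr s u = -deriv zetaQuotient (1 + s) := by
  have hw : 1 < (1 + s).re := by simpa using hs
  have habs : LSeries.abscissaOfAbsConv
      (fun n => ((ArithmeticFunction.moebius n : ℤ) : ℂ)) < (1 + s).re := by
    rw [ArithmeticFunction.abscissaOfAbsConv_moebius]; exact_mod_cast hw
  have h1 := (ArithmeticFunction.LSeriesSummable_moebius_iff.2 hw).hasSum.mul_left (2 / s ^ 3)
  have h2 := (LSeriesSummable_logMul_of_lt_re habs).hasSum.mul_left (1 / s ^ 2)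
  have h3 := hasSum_integral_of_summable_integral_norm (integrable_moebiusTerm hs)
    (summable_integral_norm_moebiusTerm hs)
  simp only [integral_moebiusTerm hs] at h3
  have h4 := h3.unique (h1.add h2)
  unfold moebiusErr
  rw [integral_sub (integrable_tsum_moebiusTerm hs) (integrable_ofReal_max_mul_cexp hs), h4,
    integral_max_mul_cexp hs, deriv_zetaQuotient hw]
  change 2 / s ^ 3 * LSeries _ (1 + s) + 1 / s ^ 2 * LSeries _ (1 + s) - _ = _
  rw [LSeries_moebius_eq hw, LSeries_logMul_moebius_eq hw, add_sub_cancel_left]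
  have hs0 : s ≠ 0 := by rintro rfl; simp at hs
  have hz := riemannZeta_ne_zero_of_one_le_re hw.le
  field_simp
  ring

lemma moebiusErr_add (s t : ℂ) (u : ℝ) :
    moebiusErr (s + t) u = Complex.exp (-(t * u)) * moebiusErr s u := by
  have h : Complex.exp (-((s + t) * u)) = Complex.exp (-(t * u)) * Complex.exp (-(s * u)) := by
    rw [← Complex.exp_add]; ring_nf
  unfold moebiusErr
  rw [mul_sub, ← tsum_mul_left, h]
  congr 1
  · refine tsum_congr fun n => ?_
    rw [moebiusTerm, moebiusTerm, h]; ring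
  · ring

lemma fourier_moebiusErr {s : ℂ} (hs : 0 < s.re) (ξ : ℝ) :
    FourierTransform.fourier (moebiusErr s) ξ =
      -deriv zetaQuotient (1 + (s + 2 * Real.pi * ξ * Complex.I)) := by
  rw [Real.fourier_real_eq_integral_exp_smul, ← integral_moebiusErr (by simpa using hs)]
  refine integral_congr_ae (Eventually.of_forall fun u => ?_)
  simp only [smul_eq_mul]
  rw [moebiusErr_add]
  congr 2
  push_cast
  ring

lemma exists_norm_deriv_zetaQuotient_le_one_add_abs :
    ∃ C : ℝ, ∀ σ ξ : ℝ, 0 < σ → σ ≤ 1 →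
      ‖deriv zetaQuotient (1 + (σ + 2 * Real.pi * ξ * Complex.I))‖ ≤
        C * (1 + ‖ξ‖) ^ (-(3 / 2) : ℝ) := by
  obtain ⟨C₁, hC₁, h₁⟩ := exists_norm_deriv_zetaQuotient_le
  obtain ⟨C₂, h₂⟩ := ((isCompact_Icc (a := (1 : ℝ)) (b := 2)).reProdIm
    (isCompact_Icc (a := (-1 : ℝ)) (b := 1))).exists_bound_of_continuousOn
    (continuousOn_deriv_zetaQuotient.mono fun w hw => by
      rw [Complex.mem_reProdIm] at hw; exact hw.1.1)
  refine ⟨max C₁ C₂ * 2 ^ (3 / 2 : ℝ), fun σ ξ hσ hσ1 => ?_⟩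
  have hre : (1 + (σ + 2 * Real.pi * ξ * Complex.I)).re = 1 + σ := by simp
  have him : (1 + (σ + 2 * Real.pi * ξ * Complex.I)).im = 2 * Real.pi * ξ := by simp
  have hC : 0 ≤ max C₁ C₂ := hC₁.trans (le_max_left _ _)
  have hhalf : 2 ^ (3 / 2 : ℝ) * (1 + ‖ξ‖) ^ (-(3 / 2) : ℝ) =
      ((1 + ‖ξ‖) / 2) ^ (-(3 / 2) : ℝ) := by
    rw [Real.div_rpow (by positivity) (by norm_num), Real.rpow_neg (by norm_num : (0 : ℝ) ≤ 2),
      div_inv_eq_mul, mul_comm]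
  rw [mul_assoc (max C₁ C₂), hhalf, Real.norm_eq_abs]
  have hpi := Real.pi_gt_three
  have habs : |2 * Real.pi * ξ| = 2 * Real.pi * |ξ| := by
    rw [abs_mul, abs_of_pos (by positivity)]
  rcases le_total 1 |2 * Real.pi * ξ| with h | h
  · refine (h₁ _ (by rw [hre]; linarith) (by rw [hre]; linarith) (by rwa [him])).trans ?_
    rw [him]
    refine mul_le_mul (le_max_left _ _) (Real.rpow_le_rpow_of_nonpos (by positivity) ?_
      (by norm_num)) (by positivity) hC
    rw [habs] at h ⊢
    nlinarith [abs_nonneg ξ]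
  · refine (h₂ _ ?_).trans ?_
    · rw [Complex.mem_reProdIm, hre, him]
      exact ⟨⟨by linarith, by linarith⟩, abs_le.1 h⟩
    · refine (le_max_right C₁ C₂).trans (le_mul_of_one_le_right hC ?_)
      refine Real.one_le_rpow_of_pos_of_le_one_of_nonpos (by positivity) ?_ (by norm_num)
      rw [habs] at h
      nlinarith [abs_nonneg ξ]

lemma integrable_one_add_norm_rpow :
    Integrable fun ξ : ℝ => (1 + ‖ξ‖) ^ (-(3 / 2) : ℝ) :=
  integrable_one_add_norm (by norm_num)

lemma continuous_deriv_zetaQuotient_line {σ : ℝ} (hσ : 0 ≤ σ) :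
    Continuous fun ξ : ℝ => deriv zetaQuotient (1 + (σ + 2 * Real.pi * ξ * Complex.I)) :=
  continuousOn_deriv_zetaQuotient.comp_continuous (by fun_prop) fun ξ => by simpa using hσ

lemma moebiusErr_eq_integral {σ : ℝ} (hσ : 0 < σ) (hσ1 : σ ≤ 1) (u : ℝ) :
    moebiusErr σ u = ∫ ξ : ℝ, Complex.exp (((2 * Real.pi * (ξ * u) : ℝ) : ℂ) * Complex.I) *
      -deriv zetaQuotient (1 + (σ + 2 * Real.pi * ξ * Complex.I)) := by
  obtain ⟨C, hC⟩ := exists_norm_deriv_zetaQuotient_le_one_add_abs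
  have hσ' : 0 < (σ : ℂ).re := by simpa using hσ
  have hf : FourierTransform.fourier (moebiusErr σ) =
      fun ξ : ℝ => -deriv zetaQuotient (1 + (σ + 2 * Real.pi * ξ * Complex.I)) :=
    funext fun ξ => fourier_moebiusErr hσ' ξ
  have hIntegrable : Integrable (FourierTransform.fourier (moebiusErr σ)) := by
    rw [hf]
    refine (integrable_one_add_norm_rpow.const_mul C).mono'
      (continuous_deriv_zetaQuotient_line hσ.le).neg.aestronglyMeasurable
      (Eventually.of_forall fun ξ => ?_)
    rw [norm_neg]
    exact hC σ ξ hσ hσ1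
  rw [← congrFun ((continuous_moebiusErr hσ').fourierInv_fourier_eq
    (integrable_moebiusErr hσ') hIntegrable) u, Real.fourierInv_eq', hf]
  simp [mul_comm]

lemma moebiusErr_zero_eq_fourierInv (u : ℝ) :
    moebiusErr 0 u = FourierTransformInv.fourierInv
      (fun ξ : ℝ => -deriv zetaQuotient (1 + (((0 : ℝ) : ℂ) + 2 * Real.pi * ξ * Complex.I))) u := by
  obtain ⟨C, hC⟩ := exists_norm_deriv_zetaQuotient_le_one_add_abs
  have hmem : ∀ᶠ σ : ℝ in 𝓝[>] 0, 0 < σ ∧ σ ≤ 1 := by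
    filter_upwards [Ioc_mem_nhdsGT (zero_lt_one' ℝ)] with σ hσ using hσ
  have h1 : Tendsto (fun σ : ℝ => moebiusErr σ u) (𝓝[>] 0) (𝓝 (moebiusErr 0 u)) := by
    have : Continuous fun σ : ℝ => Complex.exp (-((σ : ℂ) * u)) * moebiusErr 0 u := by fun_prop
    have := (this.tendsto 0).mono_left (nhdsWithin_le_nhds (s := Set.Ioi 0))
    simp only [← moebiusErr_add] at this
    simpa using this
  have h2 : Tendsto (fun σ : ℝ => moebiusErr σ u) (𝓝[>] 0)
      (𝓝 (∫ ξ : ℝ, Complex.exp (((2 * Real.pi * (ξ * u) : ℝ) : ℂ) * Complex.I) *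
        -deriv zetaQuotient (1 + (((0 : ℝ) : ℂ) + 2 * Real.pi * ξ * Complex.I)))) := by
    refine (tendsto_integral_filter_of_dominated_convergence
      (F := fun (σ : ℝ) (ξ : ℝ) => Complex.exp (((2 * Real.pi * (ξ * u) : ℝ) : ℂ) * Complex.I) *
        -deriv zetaQuotient (1 + (σ + 2 * Real.pi * ξ * Complex.I)))
      (fun ξ => C * (1 + ‖ξ‖) ^ (-(3 / 2) : ℝ)) ?_ ?_
      (integrable_one_add_norm_rpow.const_mul C) ?_).congr' ?_
    · filter_upwards [hmem] with σ hσ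
      exact ((by fun_prop : Continuous fun ξ : ℝ =>
        Complex.exp (((2 * Real.pi * (ξ * u) : ℝ) : ℂ) * Complex.I)).mul
        (continuous_deriv_zetaQuotient_line hσ.1.le).neg).aestronglyMeasurable
    · filter_upwards [hmem] with σ hσ
      refine Eventually.of_forall fun ξ => ?_
      rw [norm_mul, Complex.norm_exp_ofReal_mul_I, one_mul, norm_neg]
      exact hC σ ξ hσ.1 hσ.2
    · refine Eventually.of_forall fun ξ => (Tendsto.neg ?_).const_mul _
      have hc : ContinuousOn
          (fun σ : ℝ => deriv zetaQuotient (1 + (σ + 2 * Real.pi * ξ * Complex.I)))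
          (Set.Ici 0) :=
        continuousOn_deriv_zetaQuotient.comp (by fun_prop) fun σ hσ => by simpa using hσ
      exact (hc 0 Set.self_mem_Ici).mono_left (nhdsWithin_mono 0 Set.Ioi_subset_Ici_self)
    · filter_upwards [hmem] with σ hσ
      exact (moebiusErr_eq_integral hσ.1 hσ.2 u).symm
  rw [tendsto_nhds_unique h1 h2, Real.fourierInv_eq']
  simp [mul_comm]

lemma tendsto_moebiusErr_zero : Tendsto (moebiusErr 0) atTop (𝓝 0) := by
  have h := (Real.zero_at_infty_fourier (fun ξ : ℝ =>
    -deriv zetaQuotient (1 + (((0 : ℝ) : ℂ) + 2 * Real.pi * ξ * Complex.I)))).comp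
    (tendsto_neg_atTop_atBot.mono_right atBot_le_cocompact)
  refine h.congr fun u => ?_
  rw [Function.comp_apply, ← Real.fourierInv_eq_fourier_neg, moebiusErr_zero_eq_fourierInv]

/-- The logarithmic Möbius sum `∑_{m ≤ x, (m, ℓ) = 1} μ(m) / m log (x / m)`. -/
noncomputable def logMoebiusSum (ℓ : ℕ) (x : ℝ) : ℝ :=
  ∑ m ∈ Finset.Icc 1 ⌊x⌋₊ with m.Coprime ℓ,
    ((ArithmeticFunction.moebius m : ℤ) : ℝ) / m * Real.log (x / m)

lemma moebiusErr_zero_eq {u : ℝ} (hu : 0 ≤ u) :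
    moebiusErr 0 u = ((u * (logMoebiusSum 1 (Real.exp u) - 1) : ℝ) : ℂ) := by
  have hsum : ∑' n, moebiusTerm 0 n u = ((u * logMoebiusSum 1 (Real.exp u) : ℝ) : ℂ) := by
    rw [tsum_eq_sum (s := Finset.Icc 1 ⌊Real.exp u⌋₊), logMoebiusSum, Finset.mul_sum,
      Complex.ofReal_sum, Finset.filter_true_of_mem fun m _ => Nat.coprime_one_right m]
    · refine Finset.sum_congr rfl fun n hn => ?_
      rw [Finset.mem_Icc, Nat.le_floor_iff (Real.exp_pos u).le] at hn
      have hn0 : (0 : ℝ) < n := by exact_mod_cast hn.1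
      have hlog : Real.log n ≤ u := (Real.log_le_iff_le_exp hn0).2 hn.2
      rw [moebiusTerm, max_eq_left hu, max_eq_left (by linarith),
        Real.log_div (Real.exp_pos u).ne' hn0.ne', Real.log_exp]
      push_cast
      simp
      ring
    · intro n hn
      rcases Nat.eq_zero_or_pos n with rfl | hn0
      · simp [moebiusTerm]
      · rw [Finset.mem_Icc, not_and, Nat.le_floor_iff (Real.exp_pos u).le, not_le] at hn
        have hlog : u ≤ Real.log n :=
          (Real.le_log_iff_exp_le (by exact_mod_cast hn0)).2 (hn hn0).le
        rw [moebiusTerm, max_eq_right (a := u - Real.log n) (by linarith)]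
        simp
  rw [moebiusErr, hsum, max_eq_left hu]
  push_cast
  simp
  ring

lemma tendsto_log_mul_logMoebiusSum_sub_one :
    Tendsto (fun x => Real.log x * (logMoebiusSum 1 x - 1)) atTop (𝓝 0) := by
  have h : Tendsto (fun u : ℝ => u * (logMoebiusSum 1 (Real.exp u) - 1)) atTop (𝓝 0) := by
    have := (Complex.continuous_re.tendsto 0).comp tendsto_moebiusErr_zero
    refine this.congr' ?_
    filter_upwards [eventually_ge_atTop 0] with u hu
    rw [Function.comp_apply, moebiusErr_zero_eq hu, Complex.ofReal_re]
  refine (h.comp Real.tendsto_log_atTop).congr' ?_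
  filter_upwards [eventually_gt_atTop 0] with x hx
  rw [Function.comp_apply, Real.exp_log hx]

/-- The indicator function of the positive integers all of whose prime factors divide `ℓ`. -/
def factoredIndicator (ℓ : ℕ) : ArithmeticFunction ℤ :=
  ⟨fun n => if n ≠ 0 ∧ n.primeFactors ⊆ ℓ.primeFactors then 1 else 0, by simp⟩

/-- The Möbius function restricted to the integers coprime to `ℓ`. -/
def coprimeMoebius (ℓ : ℕ) : ArithmeticFunction ℤ :=
  ⟨fun n => if n.Coprime ℓ then ArithmeticFunction.moebius n else 0, by simp⟩

lemma isMultiplicative_factoredIndicator (ℓ : ℕ) : (factoredIndicator ℓ).IsMultiplicative := by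
  refine ArithmeticFunction.IsMultiplicative.iff_ne_zero.2 ⟨by simp [factoredIndicator], ?_⟩
  intro m n hm hn hmn
  simp only [factoredIndicator, ArithmeticFunction.coe_mk, ne_eq, mul_eq_zero, hm, hn,
    or_self, not_false_eq_true, true_and, hmn.primeFactors_mul, Finset.union_subset_iff]
  by_cases h1 : m.primeFactors ⊆ ℓ.primeFactors <;>
    by_cases h2 : n.primeFactors ⊆ ℓ.primeFactors <;> simp [h1, h2]

lemma isMultiplicative_coprimeMoebius (ℓ : ℕ) : (coprimeMoebius ℓ).IsMultiplicative := by
  refine ArithmeticFunction.IsMultiplicative.iff_ne_zero.2 ⟨by simp [coprimeMoebius], ?_⟩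
  intro m n _ _ hmn
  simp only [coprimeMoebius, ArithmeticFunction.coe_mk, Nat.coprime_mul_iff_left,
    ArithmeticFunction.isMultiplicative_moebius.map_mul_of_coprime hmn]
  split_ifs <;> simp_all

lemma factoredIndicator_mul_moebius {ℓ : ℕ} (hℓ : ℓ ≠ 0) :
    factoredIndicator ℓ * ArithmeticFunction.moebius = coprimeMoebius ℓ := by
  rw [ArithmeticFunction.IsMultiplicative.eq_iff_eq_on_prime_powers _
    ((isMultiplicative_factoredIndicator ℓ).mul ArithmeticFunction.isMultiplicative_moebius) _
    (isMultiplicative_coprimeMoebius ℓ)]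
  intro p i hp
  rcases Nat.eq_zero_or_pos i with rfl | hi
  · rw [pow_zero, ((isMultiplicative_factoredIndicator ℓ).mul
      ArithmeticFunction.isMultiplicative_moebius).map_one,
      (isMultiplicative_coprimeMoebius ℓ).map_one]
  rw [ArithmeticFunction.mul_apply]
  by_cases hpl : p ∣ ℓ
  · have h1 : ∀ x ∈ (p ^ i).divisorsAntidiagonal,
        factoredIndicator ℓ x.1 * ArithmeticFunction.moebius x.2 =
        (ArithmeticFunction.zeta : ArithmeticFunction ℤ) x.1 * ArithmeticFunction.moebius x.2 := by
      intro x hx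
      have hdvd : x.1 ∣ p ^ i := Dvd.intro _ (Nat.mem_divisorsAntidiagonal.1 hx).1
      have hx0 : x.1 ≠ 0 := ne_zero_of_dvd_ne_zero (pow_ne_zero i hp.ne_zero) hdvd
      have hsub : x.1.primeFactors ⊆ ℓ.primeFactors := by
        refine (Nat.primeFactors_mono hdvd (pow_ne_zero i hp.ne_zero)).trans ?_
        rw [Nat.primeFactors_prime_pow hi.ne' hp, Finset.singleton_subset_iff]
        exact Nat.mem_primeFactors.2 ⟨hp, hpl, hℓ⟩
      simp [factoredIndicator, hx0, hsub]
    rw [Finset.sum_congr rfl h1, ← ArithmeticFunction.mul_apply,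
      ArithmeticFunction.coe_zeta_mul_moebius, ArithmeticFunction.one_apply_ne
        (Nat.one_lt_pow hi.ne' hp.one_lt).ne']
    have : ¬ (p ^ i).Coprime ℓ := by
      rw [Nat.coprime_pow_left_iff hi, hp.coprime_iff_not_dvd]; simpa using hpl
    simp [coprimeMoebius, this]
  · have hcop : (p ^ i).Coprime ℓ := by
      rwa [Nat.coprime_pow_left_iff hi, hp.coprime_iff_not_dvd]
    rw [Finset.sum_eq_single (1, p ^ i)]
    · simp [factoredIndicator, coprimeMoebius, hcop]
    · intro x hx hne
      have hmul := (Nat.mem_divisorsAntidiagonal.1 hx).1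
      have hdvd : x.1 ∣ p ^ i := Dvd.intro _ (Nat.mem_divisorsAntidiagonal.1 hx).1
      have hx1 : x.1 ≠ 1 := by
        intro h
        rw [h, one_mul] at hmul
        exact hne (Prod.ext h hmul)
      have hpx : p ∣ x.1 := by
        obtain ⟨j, -, hj⟩ := (Nat.dvd_prime_pow hp).1 hdvd
        rw [hj] at hx1 ⊢
        exact dvd_pow_self p (by rintro rfl; simp at hx1)
      have hx0 : x.1 ≠ 0 := ne_zero_of_dvd_ne_zero (pow_ne_zero i hp.ne_zero) hdvd
      have hsub : ¬ x.1.primeFactors ⊆ ℓ.primeFactors := fun h =>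
        hpl (Nat.dvd_of_mem_primeFactors (h (Nat.mem_primeFactors.2 ⟨hp, hpx, hx0⟩)))
      simp [factoredIndicator, hsub]
    · intro h
      exact absurd (Nat.mem_divisorsAntidiagonal.2 ⟨one_mul _, pow_ne_zero i hp.ne_zero⟩) h

lemma logMoebiusSum_eq_zero_of_lt_one (ℓ : ℕ) {x : ℝ} (hx : x < 1) : logMoebiusSum ℓ x = 0 := by
  simp [logMoebiusSum, Nat.floor_eq_zero.2 hx]

lemma logMoebiusSum_one (x : ℝ) : logMoebiusSum 1 x = ∑ m ∈ Finset.Icc 1 ⌊x⌋₊,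
    ((ArithmeticFunction.moebius m : ℤ) : ℝ) / m * Real.log (x / m) := by
  rw [logMoebiusSum, Finset.filter_true_of_mem fun m _ => Nat.coprime_one_right m]

/-- Sums over pairs `(a, b)` with `a b ≤ N`, grouped by the product `a b`. -/
lemma sum_divisorsAntidiagonal_Icc {M : Type*} [AddCommMonoid M] (N : ℕ) (f : ℕ → ℕ → M) :
    ∑ n ∈ Finset.Icc 1 N, ∑ x ∈ n.divisorsAntidiagonal, f x.1 x.2 =
      ∑ a ∈ Finset.Icc 1 N, ∑ b ∈ Finset.Icc 1 (N / a), f a b := by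
  rw [Finset.sum_sigma', Finset.sum_sigma']
  refine Finset.sum_bij' (fun x _ => ⟨x.2.1, x.2.2⟩) (fun y _ => ⟨y.1 * y.2, (y.1, y.2)⟩)
    ?_ ?_ ?_ ?_ ?_
  · rintro ⟨n, a, b⟩ h
    simp only [Finset.mem_sigma, Finset.mem_Icc, Nat.mem_divisorsAntidiagonal] at h ⊢
    obtain ⟨⟨h1, h2⟩, h3, h4⟩ := h
    have ha : 0 < a := Nat.pos_of_ne_zero (by rintro rfl; simp at h3; omega)
    have hb : 0 < b := Nat.pos_of_ne_zero (by rintro rfl; simp at h3; omega)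
    refine ⟨⟨ha, ?_⟩, hb, ?_⟩
    · nlinarith
    · rw [Nat.le_div_iff_mul_le ha]; nlinarith
  · rintro ⟨a, b⟩ h
    simp only [Finset.mem_sigma, Finset.mem_Icc, Nat.mem_divisorsAntidiagonal] at h ⊢
    obtain ⟨⟨h1, h2⟩, h3, h4⟩ := h
    rw [Nat.le_div_iff_mul_le h1] at h4
    have : 0 < a * b := Nat.mul_pos h1 h3
    exact ⟨⟨this, by linarith⟩, trivial, this.ne'⟩
  · rintro ⟨n, a, b⟩ h
    simp only [Finset.mem_sigma, Finset.mem_Icc, Nat.mem_divisorsAntidiagonal] at h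
    obtain ⟨-, rfl, -⟩ := h
    rfl
  · rintro ⟨a, b⟩ h
    rfl
  · rintro ⟨n, a, b⟩ h
    rfl

lemma logMoebiusSum_eq_sum_factoredIndicator {ℓ : ℕ} (hℓ : ℓ ≠ 0) (x : ℝ) :
    logMoebiusSum ℓ x = ∑ k ∈ Finset.Icc 1 ⌊x⌋₊,
      (factoredIndicator ℓ k : ℝ) * ((k : ℝ)⁻¹ * logMoebiusSum 1 (x / k)) := by
  have hterm : ∀ n ∈ Finset.Icc 1 ⌊x⌋₊,
      (if n.Coprime ℓ then ((ArithmeticFunction.moebius n : ℤ) : ℝ) / n * Real.log (x / n) else 0) =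
      ∑ y ∈ n.divisorsAntidiagonal, (factoredIndicator ℓ y.1 : ℝ) * ((y.1 : ℝ)⁻¹ *
        (((ArithmeticFunction.moebius y.2 : ℤ) : ℝ) / y.2 * Real.log (x / y.1 / y.2))) := by
    intro n _
    have h := congrArg (fun f : ArithmeticFunction ℤ => ((f n : ℤ) : ℝ) / n * Real.log (x / n))
      (factoredIndicator_mul_moebius hℓ)
    simp only [ArithmeticFunction.mul_apply, coprimeMoebius, ArithmeticFunction.coe_mk] at h
    trans ((if n.Coprime ℓ then ArithmeticFunction.moebius n else 0 : ℤ) : ℝ) / n *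
      Real.log (x / n)
    · split_ifs <;> simp
    · rw [← h, Int.cast_sum, Finset.sum_div, Finset.sum_mul]
      refine Finset.sum_congr rfl fun y hy => ?_
      rw [← (Nat.mem_divisorsAntidiagonal.1 hy).1]
      push_cast
      rw [div_div]
      ring
  rw [logMoebiusSum, Finset.sum_filter, Finset.sum_congr rfl hterm,
    sum_divisorsAntidiagonal_Icc ⌊x⌋₊ fun a b => (factoredIndicator ℓ a : ℝ) * ((a : ℝ)⁻¹ *
        (((ArithmeticFunction.moebius b : ℤ) : ℝ) / b * Real.log (x / a / b)))]
  refine Finset.sum_congr rfl fun k _ => ?_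
  rw [logMoebiusSum_one, Nat.floor_div_natCast, Finset.mul_sum, Finset.mul_sum]

lemma logMoebiusSum_eq_tsum_factoredNumbers {ℓ : ℕ} (hℓ : ℓ ≠ 0) (x : ℝ) :
    HasSum (fun k : Nat.factoredNumbers ℓ.primeFactors =>
      ((k : ℕ) : ℝ)⁻¹ * logMoebiusSum 1 (x / (k : ℕ))) (logMoebiusSum ℓ x) := by
  rw [logMoebiusSum_eq_sum_factoredIndicator hℓ]
  have h : HasSum ((Nat.factoredNumbers ℓ.primeFactors).indicator fun k : ℕ =>
      (k : ℝ)⁻¹ * logMoebiusSum 1 (x / k)) (∑ k ∈ Finset.Icc 1 ⌊x⌋₊,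
      (factoredIndicator ℓ k : ℝ) * ((k : ℝ)⁻¹ * logMoebiusSum 1 (x / k))) := by
    have hind : ((Nat.factoredNumbers ℓ.primeFactors).indicator fun k : ℕ =>
      (k : ℝ)⁻¹ * logMoebiusSum 1 (x / k)) =
      fun k : ℕ => (factoredIndicator ℓ k : ℝ) * ((k : ℝ)⁻¹ * logMoebiusSum 1 (x / k)) := by
      funext k
      by_cases hk : k ∈ Nat.factoredNumbers ℓ.primeFactors
      · rw [Set.indicator_of_mem hk]
        rw [Nat.mem_factoredNumbers_iff_primeFactors_subset] at hk
        simp [factoredIndicator, hk]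
      · rw [Set.indicator_of_notMem hk]
        rw [Nat.mem_factoredNumbers_iff_primeFactors_subset] at hk
        simp only [factoredIndicator, ArithmeticFunction.coe_mk, if_neg hk]
        simp
    rw [hind]
    refine hasSum_sum_of_ne_finset_zero fun k hk => ?_
    rcases Nat.eq_zero_or_pos k with rfl | hk0
    · simp
    rw [Finset.mem_Icc, not_and, not_le] at hk
    rw [logMoebiusSum_eq_zero_of_lt_one, mul_zero, mul_zero]
    rw [div_lt_one (by exact_mod_cast hk0)]
    exact (Nat.floor_lt' hk0.ne').1 (hk hk0)
  exact (hasSum_subtype_iff_indicator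
    (f := fun k : ℕ => (k : ℝ)⁻¹ * logMoebiusSum 1 (x / k))).2 h

lemma hasSum_inv_factoredNumbers {ℓ : ℕ} (hℓ : ℓ ≠ 0) :
    HasSum (fun k : Nat.factoredNumbers ℓ.primeFactors => ((k : ℕ) : ℝ)⁻¹)
      ((ℓ : ℝ) / ℓ.totient) := by
  let f : ℕ →* ℝ := ⟨⟨fun n => (n : ℝ)⁻¹, by simp⟩, fun m n => by simp [mul_comm]⟩
  have h := (EulerProduct.summable_and_hasSum_factoredNumbers_prod_filter_prime_geometric
    (f := f) (fun {p} hp => by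
      change ‖(p : ℝ)⁻¹‖ < 1
      rw [norm_inv, Real.norm_natCast]
      exact inv_lt_one_of_one_lt₀ (by exact_mod_cast hp.one_lt)) ℓ.primeFactors).2
  have htot : (ℓ.totient : ℝ) = ℓ * ∏ p ∈ ℓ.primeFactors, (1 - (p : ℝ)⁻¹) := by
    have := congrArg (Rat.cast : ℚ → ℝ) (Nat.totient_eq_mul_prod_factors ℓ)
    push_cast at this
    exact this
  have hℓ' : (ℓ : ℝ) ≠ 0 := by exact_mod_cast hℓ
  rw [Finset.filter_true_of_mem fun p hp => Nat.prime_of_mem_primeFactors hp,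
    Finset.prod_inv_distrib] at h
  rwa [htot, div_mul_cancel_left₀ hℓ']

lemma exists_hasSum_inv_sqrt_factoredNumbers {ε : ℝ} (hε : 0 < ε) :
    ∃ C : ℝ, ∀ ℓ : ℕ, ℓ ≠ 0 → ∃ S : ℝ, S ≤ C * (ℓ : ℝ) ^ ε ∧
      HasSum (fun k : Nat.factoredNumbers ℓ.primeFactors => (√((k : ℕ) : ℝ))⁻¹) S := by
  have hlim : Tendsto (fun p : ℕ => (p : ℝ) ^ ε * (1 - (√(p : ℝ))⁻¹)) atTop atTop := by
    refine ((tendsto_rpow_atTop hε).comp tendsto_natCast_atTop_atTop).atTop_mul_pos one_pos ?_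
    have := (tendsto_inv_atTop_zero.comp
      (Real.tendsto_sqrt_atTop.comp (tendsto_natCast_atTop_atTop (R := ℝ)))).const_sub 1
    simpa using this
  obtain ⟨P, hP⟩ := eventually_atTop.1 (hlim.eventually_ge_atTop 1)
  refine ⟨4 ^ P, fun ℓ hℓ => ⟨∏ p ∈ ℓ.primeFactors, (1 - (√(p : ℝ))⁻¹)⁻¹, ?_, ?_⟩⟩
  · have hsqrt : ∀ p ∈ ℓ.primeFactors, (√(p : ℝ))⁻¹ ≤ 3 / 4 := fun p hp => by
      have h2 : (2 : ℝ) ≤ p := by exact_mod_cast (Nat.prime_of_mem_primeFactors hp).two_le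
      rw [inv_le_comm₀ (Real.sqrt_pos.2 (by linarith)) (by norm_num)]
      exact Real.le_sqrt_of_sq_le (by norm_num; linarith)
    have hfac : ∀ p ∈ ℓ.primeFactors, (1 - (√(p : ℝ))⁻¹)⁻¹ ≤
        (if p < P then 4 else 1) * (p : ℝ) ^ ε := fun p hp => by
      have h1 : (1 : ℝ) ≤ p := by exact_mod_cast (Nat.prime_of_mem_primeFactors hp).one_le
      have hs := hsqrt p hp
      split_ifs with hpP
      · calc (1 - (√(p : ℝ))⁻¹)⁻¹ ≤ 4 := by
              rw [inv_le_comm₀ (by linarith) (by norm_num)]; linarith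
          _ ≤ 4 * (p : ℝ) ^ ε := le_mul_of_one_le_right (by norm_num)
              (Real.one_le_rpow h1 hε.le)
      · rw [one_mul, inv_le_iff_one_le_mul₀ (by linarith)]
        exact hP p (not_lt.1 hpP)
    calc ∏ p ∈ ℓ.primeFactors, (1 - (√(p : ℝ))⁻¹)⁻¹
        ≤ ∏ p ∈ ℓ.primeFactors, ((if p < P then 4 else 1) * (p : ℝ) ^ ε) :=
          Finset.prod_le_prod (fun p hp => inv_nonneg.2 (by linarith [hsqrt p hp])) hfac
      _ = (∏ p ∈ ℓ.primeFactors, (if p < P then (4 : ℝ) else 1)) *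
            (∏ p ∈ ℓ.primeFactors, (p : ℝ)) ^ ε := by
          rw [Finset.prod_mul_distrib, Real.finsetProd_rpow _ _ fun p _ => Nat.cast_nonneg p]
      _ ≤ 4 ^ P * (ℓ : ℝ) ^ ε := by
          gcongr
          · rw [Finset.prod_ite, Finset.prod_const, Finset.prod_const_one, mul_one]
            refine pow_le_pow_right₀ (by norm_num) ?_
            calc _ ≤ (Finset.range P).card := Finset.card_le_card fun p hp => by
                  simpa using (Finset.mem_filter.1 hp).2
              _ = P := Finset.card_range P
          · rw [← Nat.cast_prod]
            exact_mod_cast Nat.le_of_dvd (Nat.pos_of_ne_zero hℓ) (Nat.prod_primeFactors_dvd ℓ)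
  · let f : ℕ →* ℝ := ⟨⟨fun n => (√(n : ℝ))⁻¹, by simp⟩, fun m n => by simp [mul_comm]⟩
    have h := (EulerProduct.summable_and_hasSum_factoredNumbers_prod_filter_prime_geometric
      (f := f) (fun {p} hp => by
        change ‖(√(p : ℝ))⁻¹‖ < 1
        rw [norm_inv, Real.norm_of_nonneg (Real.sqrt_nonneg _)]
        exact inv_lt_one_of_one_lt₀ (Real.lt_sqrt_of_sq_lt
          (by simpa using hp.one_lt))) ℓ.primeFactors).2
    rwa [Finset.filter_true_of_mem fun p hp => Nat.prime_of_mem_primeFactors hp] at h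

lemma exists_abs_logMoebiusSum_one_sub_one_le :
    ∃ C X : ℝ, 1 ≤ C ∧ 1 < X ∧ (∀ x, |logMoebiusSum 1 x - 1| ≤ C) ∧
      ∀ x, X ≤ x → |logMoebiusSum 1 x - 1| ≤ 1 / 4 / Real.log x := by
  have h := (tendsto_log_mul_logMoebiusSum_sub_one.abs).eventually_le_const
    (show |(0 : ℝ)| < 1 / 4 by norm_num)
  obtain ⟨X, hX⟩ := eventually_atTop.1 h
  set Y := max X (Real.exp 1) with hY
  have hYe : Real.exp 1 ≤ Y := le_max_right _ _
  have hY1 : 1 < Y := lt_of_lt_of_le (by simp) hYe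
  have hlarge : ∀ x, Y ≤ x → |logMoebiusSum 1 x - 1| ≤ 1 / 4 / Real.log x := fun x hx => by
    rw [le_div_iff₀ (Real.log_pos (hY1.trans_le hx))]
    have := hX x ((le_max_left _ _).trans hx)
    rwa [abs_mul, abs_of_pos (Real.log_pos (hY1.trans_le hx)), mul_comm] at this
  have hlogY : 0 ≤ Real.log Y := Real.log_nonneg hY1.le
  refine ⟨Y * Real.log Y + 1, Y, ?_, hY1, fun x => ?_, hlarge⟩
  · nlinarith
  rcases lt_or_ge x 1 with hx1 | hx1
  · rw [logMoebiusSum_eq_zero_of_lt_one 1 hx1]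
    norm_num
    nlinarith
  rcases le_total Y x with hx | hx
  · refine (hlarge x hx).trans ?_
    have : 1 ≤ Real.log x := (Real.le_log_iff_exp_le (by linarith)).2 (hYe.trans hx)
    rw [div_le_iff₀ (by linarith)]
    nlinarith [mul_nonneg (by linarith : (0:ℝ) ≤ Y) hlogY]
  · refine (abs_sub _ _).trans ?_
    rw [abs_one]
    gcongr
    rw [logMoebiusSum_one]
    refine (Finset.abs_sum_le_sum_abs _ _).trans ?_
    calc _ ≤ ∑ m ∈ Finset.Icc 1 ⌊x⌋₊, Real.log Y := by
          refine Finset.sum_le_sum fun m hm => ?_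
          rw [Finset.mem_Icc, Nat.le_floor_iff (by linarith)] at hm
          have hm0 : (1 : ℝ) ≤ m := by exact_mod_cast hm.1
          have hdiv : 1 ≤ x / m := (one_le_div (by linarith)).2 hm.2
          have hmu : |((ArithmeticFunction.moebius m : ℤ) : ℝ)| ≤ 1 := by
            exact_mod_cast ArithmeticFunction.abs_moebius_le_one
          rw [abs_mul, abs_div, abs_of_pos (by linarith : (0 : ℝ) < m),
            abs_of_nonneg (Real.log_nonneg hdiv)]
          calc _ ≤ 1 * Real.log (x / m) := by
                refine mul_le_mul_of_nonneg_right ?_ (Real.log_nonneg hdiv)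
                rw [div_le_one (by linarith)]; linarith
            _ ≤ Real.log Y := by
                rw [one_mul]
                refine Real.log_le_log (by linarith) ((div_le_self (by linarith) hm0).trans hx)
      _ = ⌊x⌋₊ * Real.log Y := by simp
      _ ≤ Y * Real.log Y := by
          gcongr
          exact (Nat.floor_le (by linarith)).trans hx

/-- Asymptotics of the logarithmic Möbius sum, uniformly for polynomially bounded moduli. -/
theorem exists_abs_logMoebiusSum_sub_le {A : ℝ} (hA : 0 < A) :
    ∃ X : ℝ, 1 < X ∧ ∀ (ℓ : ℕ) (x : ℝ), ℓ ≠ 0 → X ≤ x → (ℓ : ℝ) ≤ x ^ A →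
      |logMoebiusSum ℓ x - ℓ / ℓ.totient| ≤ (ℓ : ℝ) / ℓ.totient / Real.log x := by
  obtain ⟨C, Y, hC, hY, hbdd, hlarge⟩ := exists_abs_logMoebiusSum_one_sub_one_le
  obtain ⟨D, hD⟩ := exists_hasSum_inv_sqrt_factoredNumbers (ε := 1 / (8 * A)) (by positivity)
  have hlim : Tendsto (fun x : ℝ => C * |D| * (Real.log x / x ^ (1 / 8 : ℝ))) atTop (𝓝 0) := by
    have := (isLittleO_log_rpow_atTop (by norm_num : (0 : ℝ) < 1 / 8)).tendsto_div_nhds_zero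
    simpa using this.const_mul (C * |D|)
  obtain ⟨Z, hZ⟩ := eventually_atTop.1
    (hlim.eventually_le_const (show (0 : ℝ) < 1 / 2 by norm_num))
  refine ⟨max (Y ^ 2) Z, lt_max_of_lt_left (by nlinarith), fun ℓ x hℓ hx hℓx => ?_⟩
  have hxY : Y ^ 2 ≤ x := (le_max_left _ _).trans hx
  have hx1 : 1 < x := by nlinarith
  have hx0 : 0 < x := by linarith
  have hlog : 0 < Real.log x := Real.log_pos hx1
  obtain ⟨S, hS, hsum⟩ := hD ℓ hℓ
  have hinv := hasSum_inv_factoredNumbers hℓ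
  have hratio : 1 ≤ (ℓ : ℝ) / ℓ.totient := by
    rw [one_le_div (by exact_mod_cast Nat.totient_pos.2 (Nat.pos_of_ne_zero hℓ))]
    exact_mod_cast Nat.totient_le ℓ
  have hdiff := (logMoebiusSum_eq_tsum_factoredNumbers hℓ x).sub hinv
  have hmaj := (hinv.mul_right (1 / 2 / Real.log x)).add
    (hsum.mul_right (C * (x ^ (1 / 4 : ℝ))⁻¹))
  have hle : ‖logMoebiusSum ℓ x - ℓ / ℓ.totient‖ ≤ (ℓ : ℝ) / ℓ.totient * (1 / 2 / Real.log x) +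
      S * (C * (x ^ (1 / 4 : ℝ))⁻¹) := by
    rw [← hdiff.tsum_eq]
    refine tsum_of_norm_bounded hmaj fun k => ?_
    have hk0 : ((k : ℕ) : ℝ) ≠ 0 := by exact_mod_cast Nat.ne_zero_of_mem_factoredNumbers k.2
    have hkpos : (0 : ℝ) < (k : ℕ) := lt_of_le_of_ne (Nat.cast_nonneg _) hk0.symm
    generalize ((k : ℕ) : ℝ) = t at hkpos
    have hfac : t⁻¹ * logMoebiusSum 1 (x / t) - t⁻¹ = t⁻¹ * (logMoebiusSum 1 (x / t) - 1) := by
      ring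
    rw [hfac, Real.norm_eq_abs, abs_mul, abs_of_pos (inv_pos.2 hkpos)]
    rcases le_total t (√x) with ht | ht
    · have hxt : √x ≤ x / t := by
        rw [le_div_iff₀ hkpos]
        nlinarith [Real.mul_self_sqrt hx0.le, Real.sqrt_nonneg x]
      have hYx : Y ≤ √x := Real.le_sqrt_of_sq_le hxY
      have hlogt : Real.log x / 2 ≤ Real.log (x / t) := by
        rw [← Real.log_sqrt hx0.le]
        exact Real.log_le_log (by linarith) hxt
      have h1 : |logMoebiusSum 1 (x / t) - 1| ≤ 1 / 2 / Real.log x := by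
        refine (hlarge _ (hYx.trans hxt)).trans ?_
        rw [div_le_div_iff₀ (by linarith) hlog]
        linarith
      have : 0 ≤ (√t)⁻¹ * (C * (x ^ (1 / 4 : ℝ))⁻¹) := by positivity
      have := mul_le_mul_of_nonneg_left h1 (inv_pos.2 hkpos).le
      linarith
    · have hq : x ^ (1 / 4 : ℝ) ≤ √t := by
        have : x ^ (1 / 4 : ℝ) = √(√x) := by
          rw [Real.sqrt_eq_rpow, Real.sqrt_eq_rpow, ← Real.rpow_mul hx0.le]
          norm_num
        rw [this]
        exact Real.sqrt_le_sqrt ht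
      have hq0 : 0 < x ^ (1 / 4 : ℝ) := by positivity
      have h1 : t⁻¹ ≤ (√t)⁻¹ * (x ^ (1 / 4 : ℝ))⁻¹ := by
        rw [← mul_inv]
        refine inv_anti₀ (by positivity) ?_
        calc _ ≤ √t * √t := by gcongr
          _ = t := Real.mul_self_sqrt hkpos.le
      have h2 := mul_le_mul h1 (hbdd (x / t)) (abs_nonneg _) (by positivity)
      have : 0 ≤ t⁻¹ * (1 / 2 / Real.log x) := by positivity
      linarith
  rw [← Real.norm_eq_abs]
  refine hle.trans ?_
  have hℓpow : (ℓ : ℝ) ^ (1 / (8 * A)) ≤ x ^ (1 / 8 : ℝ) := by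
    calc (ℓ : ℝ) ^ (1 / (8 * A)) ≤ (x ^ A) ^ (1 / (8 * A)) := by gcongr
      _ = x ^ (1 / 8 : ℝ) := by
          rw [← Real.rpow_mul hx0.le]
          congr 1
          field_simp
  have htail : S * (C * (x ^ (1 / 4 : ℝ))⁻¹) ≤ 1 / 2 / Real.log x := by
    have hS' : S ≤ |D| * x ^ (1 / 8 : ℝ) := by
      refine hS.trans ((mul_le_mul_of_nonneg_right (le_abs_self D) (by positivity)).trans ?_)
      gcongr
    have hquarter : x ^ (1 / 4 : ℝ) = x ^ (1 / 8 : ℝ) * x ^ (1 / 8 : ℝ) := by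
      rw [← Real.rpow_add hx0]; norm_num
    have hp : 0 < x ^ (1 / 8 : ℝ) := by positivity
    have h1 := hZ x ((le_max_right _ _).trans hx)
    rw [le_div_iff₀ hlog]
    calc S * (C * (x ^ (1 / 4 : ℝ))⁻¹) * Real.log x
        ≤ |D| * x ^ (1 / 8 : ℝ) * (C * (x ^ (1 / 4 : ℝ))⁻¹) * Real.log x := by gcongr
      _ = C * |D| * (Real.log x / x ^ (1 / 8 : ℝ)) := by
          rw [hquarter]; field_simp
      _ ≤ 1 / 2 := h1
  have hhalf : (1 : ℝ) / 2 / Real.log x ≤ ℓ / ℓ.totient * (1 / 2 / Real.log x) :=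
    le_mul_of_one_le_left (by positivity) hratio
  calc _ ≤ (ℓ : ℝ) / ℓ.totient * (1 / 2 / Real.log x) +
        (ℓ : ℝ) / ℓ.totient * (1 / 2 / Real.log x) := by linarith
    _ = _ := by ring

lemma prod_primeFactors_one_sub_of_squarefree {e : ℕ} (he : Squarefree e) :
    ∏ p ∈ e.primeFactors, (1 - (p : ℝ)) =
      ((ArithmeticFunction.moebius e : ℤ) : ℝ) * e.totient := by
  have hmu : ArithmeticFunction.moebius e = ∏ p ∈ e.primeFactors, (-1 : ℤ) := by
    conv_lhs => rw [← Nat.prod_primeFactors_of_squarefree he]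
    rw [ArithmeticFunction.isMultiplicative_moebius.map_prod_of_subset_primeFactors _ _
      (Finset.Subset.refl _)]
    exact prod_congr rfl fun p hp =>
      ArithmeticFunction.moebius_apply_prime (Nat.prime_of_mem_primeFactors hp)
  have hphi : e.totient = ∏ p ∈ e.primeFactors, (p - 1) := by
    have h := Nat.totient_mul_prod_primeFactors e
    rw [Nat.prod_primeFactors_of_squarefree he, mul_comm] at h
    exact Nat.eq_of_mul_eq_mul_left (Nat.pos_of_ne_zero he.ne_zero) h
  rw [hmu, hphi]
  push_cast
  rw [← prod_mul_distrib]
  refine prod_congr rfl fun p hp => ?_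
  rw [Nat.cast_sub (Nat.prime_of_mem_primeFactors hp).one_le]
  push_cast
  ring

lemma sum_divisors_moebius_mul_gcd {e : ℕ} (he : Squarefree e) (n : ℕ) :
    ∑ d ∈ e.divisors, ((ArithmeticFunction.moebius d : ℤ) : ℝ) * (d.gcd n : ℝ) =
      if e ∣ n then ((ArithmeticFunction.moebius e : ℤ) : ℝ) * e.totient else 0 := by
  let f : ArithmeticFunction ℝ := ⟨fun d => if d = 0 then 0 else (d.gcd n : ℝ), by simp⟩
  have hf : f.IsMultiplicative := by
    refine ArithmeticFunction.IsMultiplicative.iff_ne_zero.2 ⟨by simp [f], ?_⟩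
    intro a b ha hb hab
    simp [f, ha, hb, Nat.gcd_comm _ n, Nat.Coprime.gcd_mul n hab]
  have hfd : ∀ d, d ≠ 0 → f d = d.gcd n := fun d hd => by simp [f, hd]
  have h := hf.prodPrimeFactors_one_sub_of_squarefree f he
  trans ∏ p ∈ e.primeFactors, (1 - (p.gcd n : ℝ))
  · rw [prod_congr rfl fun p hp => by rw [hfd p (Nat.prime_of_mem_primeFactors hp).ne_zero]] at h
    rw [h]
    exact sum_congr rfl fun d hd => by
      rw [hfd d (Nat.pos_of_mem_divisors hd).ne']
  split_ifs with hen
  · rw [← prod_primeFactors_one_sub_of_squarefree he]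
    refine prod_congr rfl fun p hp => ?_
    rw [Nat.gcd_eq_left ((Nat.dvd_of_mem_primeFactors hp).trans hen)]
  · obtain ⟨p, hp, hpn⟩ : ∃ p ∈ e.primeFactors, ¬ p ∣ n := by
      by_contra! hall
      refine hen ?_
      rw [← Nat.prod_primeFactors_of_squarefree he]
      exact Finset.prod_primes_dvd n (fun p hp => (Nat.prime_of_mem_primeFactors hp).prime) hall
    refine prod_eq_zero hp ?_
    have hgcd : p.gcd n = 1 := (Nat.prime_of_mem_primeFactors hp).coprime_iff_not_dvd.2 hpn
    rw [hgcd, Nat.cast_one, sub_self]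

lemma sum_divisorsAntidiagonal_moebius_mul_gcd (q e n : ℕ) :
    ∑ x ∈ e.divisorsAntidiagonal, (if x.1.gcd q = 1 then
      ((ArithmeticFunction.moebius x.1 : ℤ) : ℝ) / x.1.totient * (x.1.gcd n : ℝ) *
        (if x.2.gcd (q * x.1) = 1 then
          ((ArithmeticFunction.moebius x.2 : ℤ) : ℝ) ^ 2 / (x.2.totient : ℝ) else 0) else 0) =
      if e.Coprime q ∧ e ∣ n then ((ArithmeticFunction.moebius e : ℤ) : ℝ) else 0 := by
  by_cases hsq : Squarefree e ∧ e.Coprime q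
  · obtain ⟨hsq, hcop⟩ := hsq
    have htot : (e.totient : ℝ) ≠ 0 := by
      exact_mod_cast (Nat.totient_pos.2 (Nat.pos_of_ne_zero hsq.ne_zero)).ne'
    have hterm : ∀ x ∈ e.divisorsAntidiagonal, (if x.1.gcd q = 1 then
      ((ArithmeticFunction.moebius x.1 : ℤ) : ℝ) / x.1.totient * (x.1.gcd n : ℝ) *
        (if x.2.gcd (q * x.1) = 1 then
          ((ArithmeticFunction.moebius x.2 : ℤ) : ℝ) ^ 2 / (x.2.totient : ℝ) else 0) else 0) =
        ((ArithmeticFunction.moebius x.1 : ℤ) : ℝ) * (x.1.gcd n : ℝ) / e.totient := by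
      intro x hx
      obtain ⟨rfl, -⟩ := Nat.mem_divisorsAntidiagonal.1 hx
      rw [Nat.squarefree_mul_iff] at hsq
      obtain ⟨hab, ha, hb⟩ := hsq
      rw [Nat.coprime_mul_iff_left] at hcop
      have hb2 : ((ArithmeticFunction.moebius x.2 : ℤ) : ℝ) ^ 2 = 1 := by
        exact_mod_cast ArithmeticFunction.moebius_sq_eq_one_of_squarefree hb
      have hc : x.2.gcd (q * x.1) = 1 := Nat.Coprime.mul_right hcop.2 hab.symm
      have ha' : x.1.gcd q = 1 := hcop.1
      rw [if_pos ha', if_pos hc, hb2, Nat.totient_mul hab]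
      push_cast
      field_simp
    rw [sum_congr rfl hterm, ← sum_div,
      Nat.sum_divisorsAntidiagonal fun d _ =>
        ((ArithmeticFunction.moebius d : ℤ) : ℝ) * (d.gcd n : ℝ),
      sum_divisors_moebius_mul_gcd hsq n]
    by_cases hen : e ∣ n <;> simp [hcop, hen, htot]
  · have hrhs : (if e.Coprime q ∧ e ∣ n then
        ((ArithmeticFunction.moebius e : ℤ) : ℝ) else 0) = 0 := by
      split_ifs with h
      · rw [ArithmeticFunction.moebius_eq_zero_of_not_squarefree fun h' => hsq ⟨h', h.1⟩,
          Int.cast_zero]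
      · rfl
    rw [hrhs]
    refine sum_eq_zero fun x hx => ?_
    obtain ⟨rfl, -⟩ := Nat.mem_divisorsAntidiagonal.1 hx
    split_ifs with h1 h2
    · have h2' := Nat.coprime_mul_iff_right.1 (show x.2.Coprime (q * x.1) from h2)
      rw [Nat.squarefree_mul_iff, Nat.coprime_mul_iff_left] at hsq
      by_cases ha : Squarefree x.1
      · have hb : ¬ Squarefree x.2 := fun hb => hsq ⟨⟨h2'.2.symm, ha, hb⟩, h1, h2'.1⟩
        simp [ArithmeticFunction.moebius_eq_zero_of_not_squarefree hb]
      · simp [ArithmeticFunction.moebius_eq_zero_of_not_squarefree ha]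
    · simp
    · rfl

lemma Gsum_pos (q : ℕ) {R : ℝ} (hR : 1 ≤ R) : 0 < Gsum q R := by
  unfold Gsum
  have hmem : 1 ∈ Icc 1 ⌊R⌋₊ := mem_Icc.2 ⟨le_rfl, Nat.le_floor (by simpa using hR)⟩
  refine lt_of_lt_of_le ?_ (single_le_sum (fun r _ => ?_) hmem)
  · simp
  · split_ifs <;> positivity

/-- The Selberg weights diagonalise the quadratic form: summing them against `gcd(d, n) / d`
produces a truncated Möbius sum over the divisors of `n`. -/
lemma sum_selbergLambda_mul_gcd_div (q : ℕ) (R : ℝ) (n : ℕ) :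
    ∑ d ∈ Icc 1 ⌊R⌋₊, selbergLambda q R d * (d.gcd n : ℝ) / d =
      (∑ e ∈ Icc 1 ⌊R⌋₊, if e.Coprime q ∧ e ∣ n then
        ((ArithmeticFunction.moebius e : ℤ) : ℝ) else 0) / Gsum q R := by
  rw [← sum_congr rfl fun e _ => sum_divisorsAntidiagonal_moebius_mul_gcd q e n,
    sum_divisorsAntidiagonal_Icc ⌊R⌋₊ fun a b => (if a.gcd q = 1 then
      ((ArithmeticFunction.moebius a : ℤ) : ℝ) / a.totient * (a.gcd n : ℝ) *
        (if b.gcd (q * a) = 1 then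
          ((ArithmeticFunction.moebius b : ℤ) : ℝ) ^ 2 / (b.totient : ℝ) else 0) else 0), sum_div]
  refine sum_congr rfl fun d hd => ?_
  rw [mem_Icc] at hd
  have hd0 : (d : ℝ) ≠ 0 := by exact_mod_cast (by omega : d ≠ 0)
  have hdR : (d : ℝ) ≤ R := (Nat.le_floor_iff' (by omega)).1 hd.2
  unfold selbergLambda
  by_cases hdq : d.gcd q = 1
  · simp only [hdq, hdR, and_self, if_true]
    rw [← mul_sum, ← Nat.floor_div_natCast, ← Gsum]
    field_simp
  · simp [hdq]

lemma selbergLambda_eq_zero_of_lt {q : ℕ} {R : ℝ} {d : ℕ} (h : R < d) :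
    selbergLambda q R d = 0 := if_neg fun h' => h'.1.not_gt h

lemma bvTheta'_eq_zero_of_lt {U U₁ : ℝ} (hU : U ≤ U₁) {d : ℕ} (h : U₁ < d) :
    bvTheta' U U₁ d = 0 := by
  rw [bvTheta', if_neg (by linarith), if_neg (by linarith)]

lemma hFun_eq_sum_Icc (q : ℕ) (R : ℝ) {U U₁ : ℝ} (hU : U ≤ U₁) {m : ℕ} (hm : m ≠ 0) :
    hFun q R U U₁ m = ∑ p ∈ Icc 1 ⌊R⌋₊ ×ˢ Icc 1 ⌊U₁⌋₊ with p.1.lcm p.2 = m,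
      selbergLambda q R p.1 * bvTheta' U U₁ p.2 := by
  symm
  refine sum_subset (fun p hp => ?_) fun p hp hp' => ?_
  · simp only [mem_filter, mem_product, Nat.mem_divisors] at hp ⊢
    obtain ⟨-, rfl⟩ := hp
    exact ⟨⟨⟨Nat.dvd_lcm_left _ _, hm⟩, Nat.dvd_lcm_right _ _, hm⟩, rfl⟩
  · simp only [mem_filter, mem_product, Nat.mem_divisors, mem_Icc] at hp hp'
    have h1 : p.1 ≠ 0 := ne_zero_of_dvd_ne_zero hm hp.1.1.1
    have h2 : p.2 ≠ 0 := ne_zero_of_dvd_ne_zero hm hp.1.2.1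
    by_contra hne
    refine hp' ⟨⟨⟨Nat.pos_of_ne_zero h1, (Nat.le_floor_iff' h1).2 ?_⟩,
      Nat.pos_of_ne_zero h2, (Nat.le_floor_iff' h2).2 ?_⟩, hp.2⟩
    · by_contra hlt
      exact hne (by rw [selbergLambda_eq_zero_of_lt (not_le.1 hlt), zero_mul])
    · by_contra hlt
      exact hne (by rw [bvTheta'_eq_zero_of_lt hU (not_le.1 hlt), mul_zero])

lemma sum_hFun_div_eq_sum_Icc (q₀ q : ℕ) {R U U₁ : ℝ} (hR : 0 ≤ R) (hU : U ≤ U₁) (hU₁ : 0 ≤ U₁) :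
    ∑ m ∈ Icc 1 ⌊U₁ * R⌋₊ with q₀ ∣ m, hFun q R U U₁ m / m =
      ∑ p ∈ Icc 1 ⌊R⌋₊ ×ˢ Icc 1 ⌊U₁⌋₊ with q₀ ∣ p.1.lcm p.2,
        selbergLambda q R p.1 * bvTheta' U U₁ p.2 / (p.1.lcm p.2 : ℕ) := by
  have hmaps : ∀ p ∈ {p ∈ Icc 1 ⌊R⌋₊ ×ˢ Icc 1 ⌊U₁⌋₊ | q₀ ∣ p.1.lcm p.2},
      p.1.lcm p.2 ∈ {m ∈ Icc 1 ⌊U₁ * R⌋₊ | q₀ ∣ m} := fun p hp => by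
    simp only [mem_filter, mem_product, mem_Icc] at hp ⊢
    obtain ⟨⟨⟨h1, h2⟩, h3, h4⟩, h5⟩ := hp
    refine ⟨⟨Nat.lcm_pos h1 h3, Nat.le_floor ?_⟩, h5⟩
    rw [Nat.le_floor_iff hR] at h2
    rw [Nat.le_floor_iff hU₁] at h4
    calc ((p.1.lcm p.2 : ℕ) : ℝ) ≤ (p.1 * p.2 : ℕ) := by
          exact_mod_cast Nat.le_of_dvd (Nat.mul_pos h1 h3) (Nat.lcm_dvd_mul _ _)
      _ = p.2 * p.1 := by push_cast; ring
      _ ≤ U₁ * R := by gcongr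
  rw [← sum_fiberwise_of_maps_to hmaps]
  refine sum_congr rfl fun m hm => ?_
  rw [mem_filter, mem_Icc] at hm
  rw [hFun_eq_sum_Icc q R hU (by omega), sum_div, filter_filter]
  refine sum_congr (filter_congr fun p _ => ?_) fun p hp => ?_
  · constructor
    · rintro rfl
      exact ⟨hm.2, rfl⟩
    · exact fun h => h.2
  · rw [(mem_filter.1 hp).2.2]

lemma sum_hFun_div_eq_sum_moebius {q₀ q : ℕ} (hq : q₀ ∣ q) {R U U₁ : ℝ} (hR : 0 ≤ R)
    (hU : U ≤ U₁) (hU₁ : 0 ≤ U₁) :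
    ∑ m ∈ Icc 1 ⌊U₁ * R⌋₊ with q₀ ∣ m, hFun q R U U₁ m / m =
      (∑ e ∈ Icc 1 ⌊R⌋₊ with e.Coprime q, ((ArithmeticFunction.moebius e : ℤ) : ℝ) *
        ∑ d ∈ Icc 1 ⌊U₁⌋₊ with q₀ * e ∣ d, bvTheta' U U₁ d / d) / Gsum q R := by
  have hterm : ∀ a ∈ Icc 1 ⌊R⌋₊, ∀ d ∈ Icc 1 ⌊U₁⌋₊, (if q₀ ∣ a.lcm d then
      selbergLambda q R a * bvTheta' U U₁ d / (a.lcm d : ℕ) else 0) =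
      if q₀ ∣ d then bvTheta' U U₁ d / d * (selbergLambda q R a * (a.gcd d : ℝ) / a) else 0 := by
    intro a ha d hd
    rw [mem_Icc] at ha hd
    by_cases haq : a.gcd q = 1
    · have hcop : q₀.Coprime a := (Nat.Coprime.coprime_dvd_right hq haq).symm
      have hiff : q₀ ∣ a.lcm d ↔ q₀ ∣ d :=
        ⟨fun h => hcop.dvd_of_dvd_mul_left (h.trans (Nat.lcm_dvd_mul a d)),
          fun h => h.trans (Nat.dvd_lcm_right a d)⟩
      simp only [hiff]
      refine if_congr Iff.rfl ?_ rfl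
      have hgl : (a.gcd d : ℝ) * (a.lcm d : ℕ) = a * d := by exact_mod_cast Nat.gcd_mul_lcm a d
      have ha0 : (a : ℝ) ≠ 0 := by exact_mod_cast (by omega : a ≠ 0)
      have hd0 : (d : ℝ) ≠ 0 := by exact_mod_cast (by omega : d ≠ 0)
      have hl0 : ((a.lcm d : ℕ) : ℝ) ≠ 0 := by
        exact_mod_cast (Nat.lcm_pos ha.1 hd.1).ne'
      field_simp
      linear_combination (-selbergLambda q R a * bvTheta' U U₁ d) * hgl
    · have : selbergLambda q R a = 0 := if_neg fun h => haq h.2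
      simp [this]
  rw [sum_hFun_div_eq_sum_Icc q₀ q hR hU hU₁, sum_filter, sum_product,
    sum_congr rfl fun a ha => sum_congr rfl (hterm a ha), sum_comm]
  have hinner : ∀ d ∈ Icc 1 ⌊U₁⌋₊, (∑ a ∈ Icc 1 ⌊R⌋₊, if q₀ ∣ d then
      bvTheta' U U₁ d / d * (selbergLambda q R a * (a.gcd d : ℝ) / a) else 0) =
      ∑ e ∈ Icc 1 ⌊R⌋₊, if e.Coprime q then (if q₀ * e ∣ d then
        ((ArithmeticFunction.moebius e : ℤ) : ℝ) * (bvTheta' U U₁ d / d) else 0) / Gsum q R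
        else 0 := by
    intro d _
    by_cases hd : q₀ ∣ d
    · simp only [hd, if_true]
      rw [← mul_sum, sum_selbergLambda_mul_gcd_div, sum_div, mul_sum]
      refine sum_congr rfl fun e _ => ?_
      by_cases he : e.Coprime q
      · have hiff : q₀ * e ∣ d ↔ e ∣ d :=
          ⟨fun h => (dvd_mul_left e q₀).trans h,
            fun h => (Nat.Coprime.coprime_dvd_right hq he).symm.mul_dvd_of_dvd_of_dvd hd h⟩
        rw [if_pos he]
        by_cases hed : e ∣ d
        · rw [if_pos ⟨he, hed⟩, if_pos (hiff.2 hed)]; ring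
        · rw [if_neg fun h => hed h.2, if_neg fun h => hed (hiff.1 h)]; ring
      · simp [he]
    · have hnot : ∀ e, ¬ q₀ * e ∣ d := fun e h => hd ((dvd_mul_right q₀ e).trans h)
      simp [hd, hnot]
  rw [sum_congr rfl hinner, sum_comm, sum_filter, sum_div]
  refine sum_congr rfl fun e _ => ?_
  split_ifs
  · rw [sum_filter, mul_sum, sum_div]
    refine sum_congr rfl fun d _ => ?_
    split_ifs <;> simp
  · simp

lemma moebius_mul_of_coprime_or (D m : ℕ) : ArithmeticFunction.moebius (D * m) =
    if m.Coprime D then ArithmeticFunction.moebius D * ArithmeticFunction.moebius m else 0 := by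
  split_ifs with h
  · exact ArithmeticFunction.isMultiplicative_moebius.map_mul_of_coprime h.symm
  · refine ArithmeticFunction.moebius_eq_zero_of_not_squarefree fun hsq => h ?_
    exact (Nat.squarefree_mul_iff.1 hsq).1.symm

lemma sum_multiples_moebius_log {D : ℕ} (hD : D ≠ 0) (V : ℝ) :
    ∑ d ∈ Icc 1 ⌊V⌋₊ with D ∣ d, ((ArithmeticFunction.moebius d : ℤ) : ℝ) / d * Real.log (V / d) =
      ((ArithmeticFunction.moebius D : ℤ) : ℝ) / D * logMoebiusSum D (V / D) := by
  have hset : {d ∈ Icc 1 ⌊V⌋₊ | D ∣ d} = (Icc 1 (⌊V⌋₊ / D)).image (D * ·) := by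
    ext d
    simp only [mem_filter, mem_Icc, mem_image]
    constructor
    · rintro ⟨⟨h1, h2⟩, m, rfl⟩
      refine ⟨m, ⟨Nat.pos_of_ne_zero (by rintro rfl; simp at h1), ?_⟩, rfl⟩
      rw [Nat.le_div_iff_mul_le (Nat.pos_of_ne_zero hD), mul_comm]
      exact h2
    · rintro ⟨m, ⟨h1, h2⟩, rfl⟩
      rw [Nat.le_div_iff_mul_le (Nat.pos_of_ne_zero hD), mul_comm] at h2
      exact ⟨⟨Nat.mul_pos (Nat.pos_of_ne_zero hD) h1, h2⟩, dvd_mul_right D m⟩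
  rw [hset, sum_image fun a _ b _ h => Nat.eq_of_mul_eq_mul_left (Nat.pos_of_ne_zero hD) h,
    logMoebiusSum, Nat.floor_div_natCast, sum_filter, mul_sum]
  refine sum_congr rfl fun m _ => ?_
  rw [moebius_mul_of_coprime_or]
  split_ifs
  · push_cast
    rw [div_div]
    ring
  · simp

lemma bvTheta'_eq {U U₁ : ℝ} (hU : 0 < U) (hUU : U < U₁) {d : ℕ} (hd : d ≠ 0) (hd₁ : (d : ℝ) ≤ U₁) :
    bvTheta' U U₁ d = (((ArithmeticFunction.moebius d : ℤ) : ℝ) * Real.log (U₁ / d) -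
      if (d : ℝ) ≤ U then ((ArithmeticFunction.moebius d : ℤ) : ℝ) * Real.log (U / d) else 0) /
      Real.log (U₁ / U) := by
  have hd0 : (d : ℝ) ≠ 0 := by exact_mod_cast hd
  have hlog : Real.log (U₁ / U) ≠ 0 := (Real.log_pos ((one_lt_div hU).2 hUU)).ne'
  rw [bvTheta', if_pos hd₁]
  split_ifs with h
  · rw [← mul_sub, Real.log_div (by linarith) hd0, Real.log_div hU.ne' hd0,
      sub_sub_sub_cancel_right, ← Real.log_div (by linarith) hU.ne', mul_div_cancel_right₀ _ hlog]
  · rw [sub_zero]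

lemma sum_multiples_bvTheta' {U U₁ : ℝ} (hU : 0 < U) (hUU : U < U₁) {D : ℕ} (hD : D ≠ 0) :
    ∑ d ∈ Icc 1 ⌊U₁⌋₊ with D ∣ d, bvTheta' U U₁ d / d =
      ((ArithmeticFunction.moebius D : ℤ) : ℝ) / D *
        (logMoebiusSum D (U₁ / D) - logMoebiusSum D (U / D)) / Real.log (U₁ / U) := by
  rw [mul_sub, ← sum_multiples_moebius_log hD, ← sum_multiples_moebius_log hD]
  have hsub : {d ∈ Icc 1 ⌊U⌋₊ | D ∣ d} =
      filter (fun d : ℕ => (d : ℝ) ≤ U) {d ∈ Icc 1 ⌊U₁⌋₊ | D ∣ d} := by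
    ext d
    simp only [mem_filter, mem_Icc, Nat.le_floor_iff hU.le, Nat.le_floor_iff (hU.trans hUU).le]
    constructor
    · rintro ⟨⟨h1, h2⟩, h3⟩
      exact ⟨⟨⟨h1, by linarith⟩, h3⟩, h2⟩
    · rintro ⟨⟨⟨h1, -⟩, h3⟩, h2⟩
      exact ⟨⟨h1, h2⟩, h3⟩
  rw [hsub, sum_filter (s := {d ∈ Icc 1 ⌊U₁⌋₊ | D ∣ d}), ← sum_sub_distrib, sum_div]
  refine sum_congr rfl fun d hd => ?_
  rw [mem_filter, mem_Icc, Nat.le_floor_iff (hU.trans hUU).le] at hd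
  rw [bvTheta'_eq hU hUU (by omega) hd.1.2]
  split_ifs <;> ring

/-- Lemma 4.7 (a): if `q₀ ∣ q`, `U < y` and `U > (q₀R)^{1+ρ}` (with `U/(q₀R)`
sufficiently large in terms of `ρ`), then
`|∑_{m ≡ 0 (mod q₀)} h(m)/m| ≤ 2/(φ(q₀) log(U₁/U) log(U/(q₀R)))`. -/
theorem statement19 (ρ : ℝ) (hρ0 : 0 < ρ) (hρ1 : ρ < 1 / 8) :
    ∃ Z₀ : ℝ, ∀ (q₀ q : ℕ) (R U U₁ y : ℝ),
      1 ≤ q₀ → q₀ ∣ q → 1 < R → 1 < U → U < U₁ → U < y →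
      ((q₀ : ℝ) * R) ^ (1 + ρ) < U →
      Z₀ ≤ U / (q₀ * R) →
      |∑ m ∈ (Finset.Icc 1 ⌊U₁ * R⌋₊).filter (fun m => q₀ ∣ m),
          hFun q R U U₁ m / m| ≤
        2 / (Nat.totient q₀ * Real.log (U₁ / U) * Real.log (U / (q₀ * R))) := by
  obtain ⟨X, hX, hmain⟩ := exists_abs_logMoebiusSum_sub_le (A := 1 / ρ) (by positivity)
  refine ⟨X, fun q₀ q R U U₁ y hq₀ hq hR hU hUU _ hUR hZ => ?_⟩
  have hq₀' : (1 : ℝ) ≤ q₀ := by exact_mod_cast hq₀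
  have hU0 : 0 < U := by linarith
  have hqR : 1 < (q₀ : ℝ) * R := by nlinarith
  have hlogU : 0 < Real.log (U₁ / U) := Real.log_pos ((one_lt_div hU0).2 hUU)
  have hlogZ : 0 < Real.log (U / (q₀ * R)) := Real.log_pos (hX.trans_le hZ)
  have hG := Gsum_pos q hR.le
  have hφ : (0 : ℝ) < q₀.totient := by exact_mod_cast Nat.totient_pos.2 hq₀
  have hZρ : ((q₀ : ℝ) * R) ^ ρ ≤ U / (q₀ * R) := by
    rw [le_div_iff₀ (by linarith)]
    rw [Real.rpow_add (by linarith), Real.rpow_one] at hUR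
    linarith
  have hbound : ∀ e ∈ Icc 1 ⌊R⌋₊, ∀ V, U ≤ V →
      |logMoebiusSum (q₀ * e) (V / (q₀ * e : ℕ)) - (q₀ * e : ℕ) / (q₀ * e).totient| ≤
        ((q₀ * e : ℕ) : ℝ) / (q₀ * e).totient / Real.log (U / (q₀ * R)) := by
    intro e he V hV
    rw [mem_Icc, Nat.le_floor_iff (by linarith)] at he
    have he1 : (1 : ℝ) ≤ e := by exact_mod_cast he.1
    have hD : q₀ * e ≠ 0 := (Nat.mul_pos hq₀ he.1).ne'
    have hDR : ((q₀ * e : ℕ) : ℝ) ≤ q₀ * R := by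
      push_cast
      gcongr
      exact he.2
    have hD0 : (0 : ℝ) < (q₀ * e : ℕ) := by exact_mod_cast Nat.pos_of_ne_zero hD
    have hx : U / (q₀ * R) ≤ V / (q₀ * e : ℕ) := by
      gcongr
      linarith
    refine (hmain (q₀ * e) _ hD (hZ.trans hx) ?_).trans ?_
    · calc ((q₀ * e : ℕ) : ℝ) ≤ q₀ * R := hDR
        _ = (((q₀ : ℝ) * R) ^ ρ) ^ (1 / ρ) := by
            rw [← Real.rpow_mul (by linarith), mul_one_div_cancel hρ0.ne', Real.rpow_one]
        _ ≤ _ := by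
            gcongr
            exact hZρ.trans hx
    · gcongr
  rw [sum_hFun_div_eq_sum_moebius hq (by linarith) hUU.le (by linarith), abs_div, abs_of_pos hG,
    div_le_iff₀ hG]
  calc _ ≤ ∑ e ∈ Icc 1 ⌊R⌋₊ with e.Coprime q,
        ((ArithmeticFunction.moebius e : ℤ) : ℝ) ^ 2 / e.totient *
          (2 / (q₀.totient * Real.log (U₁ / U) * Real.log (U / (q₀ * R)))) := by
        refine (abs_sum_le_sum_abs _ _).trans (sum_le_sum fun e he => ?_)
        rw [mem_filter] at he
        have he1 : 1 ≤ e := (mem_Icc.1 he.1).1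
        have hD : q₀ * e ≠ 0 := (Nat.mul_pos hq₀ he1).ne'
        have hφe : (0 : ℝ) < e.totient := by exact_mod_cast Nat.totient_pos.2 he1
        have he0 : (0 : ℝ) < e := by exact_mod_cast he1
        have hcop : q₀.Coprime e := (Nat.Coprime.coprime_dvd_right hq he.2).symm
        have hdiff : |logMoebiusSum (q₀ * e) (U₁ / (q₀ * e : ℕ)) -
            logMoebiusSum (q₀ * e) (U / (q₀ * e : ℕ))| ≤
            2 * (((q₀ * e : ℕ) : ℝ) / (q₀ * e).totient / Real.log (U / (q₀ * R))) := by
          refine (abs_sub_le _ (((q₀ * e : ℕ) : ℝ) / (q₀ * e).totient) _).trans ?_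
          rw [two_mul, abs_sub_comm _ (logMoebiusSum (q₀ * e) (U / (q₀ * e : ℕ)))]
          exact add_le_add (hbound e he.1 U₁ hUU.le) (hbound e he.1 U le_rfl)
        rw [sum_multiples_bvTheta' hU0 hUU hD, abs_mul, abs_div, abs_mul, abs_div,
          abs_of_pos hlogU, Nat.abs_cast]
        have hmuD : |((ArithmeticFunction.moebius (q₀ * e) : ℤ) : ℝ)| ≤ 1 := by
          exact_mod_cast ArithmeticFunction.abs_moebius_le_one
        have hmu : |((ArithmeticFunction.moebius e : ℤ) : ℝ)| =
            ((ArithmeticFunction.moebius e : ℤ) : ℝ) ^ 2 := by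
          rcases ArithmeticFunction.moebius_eq_or e with h | h | h <;> simp [h]
        rw [hmu]
        calc _ ≤ ((ArithmeticFunction.moebius e : ℤ) : ℝ) ^ 2 *
              (1 / ((q₀ * e : ℕ) : ℝ) *
                (2 * (((q₀ * e : ℕ) : ℝ) / (q₀ * e).totient / Real.log (U / (q₀ * R)))) /
                Real.log (U₁ / U)) := by gcongr
          _ = _ := by
              rw [Nat.totient_mul hcop]
              push_cast
              field_simp
    _ = _ := by
        rw [← sum_mul, mul_comm, Gsum, sum_filter]
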